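/- arXiv:1112.4726 — 6 statements merged into one kernel-verified Lean document; each statement's English description precedes it below -/
import Mathlib

section
/- For every nonzero real number z, the integral ∫_ℝ e^{2πizx}/cosh(πx)² dx converges and equals 4z/(e^{πz} − e^{−πz}). -/
open Real MeasureTheory

theorem aux_cosh (x : ℝ) :
    sigmoid (2 * π * x) * (1 - sigmoid (2 * π * x)) * 4 = (Real.cosh (π * x) ^ 2)⁻¹ := by
  have hE := Real.exp_pos (π * x)
  have h1 : Real.exp (-(2 * π * x)) = (Real.exp (π * x))⁻¹ ^ 2 := by
    rw [← Real.exp_neg, ← Real.exp_nat_mul]; congr 1; push_cast; ring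
  rw [sigmoid_def, Real.cosh_eq, h1, Real.exp_neg]
  set E := Real.exp (π * x)
  have : E ^ 2 + 1 ≠ 0 := by positivity
  field_simp
  ring

theorem aux_point (z x : ℝ) :
    (2 / π : ℂ) * (|sigmoid (2 * π * x) * (1 - sigmoid (2 * π * x)) * (2 * π)| •
      (((sigmoid (2 * π * x) : ℝ) : ℂ) ^ ((1 + Complex.I * z) - 1) *
        (1 - ((sigmoid (2 * π * x) : ℝ) : ℂ)) ^ ((1 - Complex.I * z) - 1))) =
    Complex.exp (2 * π * Complex.I * z * x) / (Real.cosh (π * x) : ℂ) ^ 2 := by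
  have hc := aux_cosh x
  have h2 := sigmoid_mul_rexp_neg (2 * π * x)
  rw [sigmoid_neg] at h2
  have hp := sigmoid_pos (2 * π * x)
  have hl : 0 < 1 - sigmoid (2 * π * x) := sub_pos.2 (sigmoid_lt_one _)
  set s := sigmoid (2 * π * x)
  have hlog : Real.log (1 - s) = Real.log s - 2 * π * x := by
    rw [← h2, Real.log_mul hp.ne' (Real.exp_pos _).ne', Real.log_exp]; ring
  have hπ : (π : ℂ) ≠ 0 := by exact_mod_cast pi_ne_zero
  rw [abs_of_pos (by positivity), div_eq_mul_inv (Complex.exp _)]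
  have hc' : ((Real.cosh (π * x) : ℂ) ^ 2)⁻¹ = (s : ℂ) * (1 - s) * 4 := by
    rw [← Complex.ofReal_pow, ← Complex.ofReal_inv, ← hc]; push_cast; ring
  have h1s : (1 - (s : ℂ)) = ((1 - s : ℝ) : ℂ) := by push_cast; ring
  have hpow : (s : ℂ) ^ ((1 + Complex.I * z) - 1) * (1 - (s : ℂ)) ^ ((1 - Complex.I * z) - 1)
      = Complex.exp (2 * π * Complex.I * z * x) := by
    rw [h1s, Complex.cpow_def_of_ne_zero (by exact_mod_cast hp.ne'),
      Complex.cpow_def_of_ne_zero (by exact_mod_cast hl.ne'), ← Complex.ofReal_log hp.le,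
      ← Complex.ofReal_log hl.le, hlog, ← Complex.exp_add]
    congr 1
    push_cast
    ring
  rw [hpow, hc', Complex.real_smul]
  push_cast
  field_simp
  ring

theorem aux_beta (z : ℝ) (hz : z ≠ 0) :
    (2 / π : ℂ) * Complex.betaIntegral (1 + Complex.I * z) (1 - Complex.I * z) =
      4 * z / (Real.exp (π * z) - Real.exp (-(π * z))) := by
  have hb := Complex.Gamma_mul_Gamma_eq_betaIntegral (s := 1 + Complex.I * z)
    (t := 1 - Complex.I * z) (by simp) (by simp)
  have hw : Complex.I * (z : ℂ) ≠ 0 := mul_ne_zero Complex.I_ne_zero (by exact_mod_cast hz)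
  have h2 : (1 + Complex.I * z) + (1 - Complex.I * z) = (1 : ℂ) + 1 := by ring
  rw [h2, Complex.Gamma_add_one 1 one_ne_zero, Complex.Gamma_one, mul_one, one_mul,
    add_comm (1 : ℂ) (Complex.I * z), Complex.Gamma_add_one _ hw, mul_assoc,
    Complex.Gamma_mul_Gamma_one_sub] at hb
  rw [add_comm (1 : ℂ) (Complex.I * z), ← hb]
  have h3 : (π : ℂ) * (Complex.I * z) = ((π * z : ℝ) : ℂ) * Complex.I := by push_cast; ring
  rw [h3, Complex.sin_mul_I, ← Complex.ofReal_sinh]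
  have h4 : Real.sinh (π * z) ≠ 0 := by
    rw [Ne, Real.sinh_eq_zero]; exact mul_ne_zero pi_ne_zero hz
  have h5 : (Real.exp (π * z) - Real.exp (-(π * z)) : ℂ) = 2 * (Real.sinh (π * z) : ℂ) := by
    rw [Real.sinh_eq]; push_cast; ring
  rw [h5]
  have h6 : (Real.sinh (π * z) : ℂ) ≠ 0 := by exact_mod_cast h4
  have hπ : (π : ℂ) ≠ 0 := by exact_mod_cast pi_ne_zero
  have hI := Complex.I_ne_zero
  generalize (Real.sinh (π * z) : ℂ) = S at *
  field_simp
  ring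

open Real MeasureTheory

/-- For every nonzero real number `z`, the integral `∫_ℝ e^{2πizx}/cosh(πx)² dx`
converges and equals `4z/(e^{πz} − e^{−πz})`. -/
theorem stmt_0 (z : ℝ) (hz : z ≠ 0) :
    Integrable (fun x : ℝ =>
      Complex.exp (2 * π * Complex.I * z * x) / (Real.cosh (π * x) : ℂ) ^ 2) ∧
    ∫ x : ℝ, Complex.exp (2 * π * Complex.I * z * x) / (Real.cosh (π * x) : ℂ) ^ 2
      = 4 * z / (Real.exp (π * z) - Real.exp (-(π * z))) := by
  have hd : ∀ x ∈ (Set.univ : Set ℝ), HasDerivWithinAt (fun x : ℝ => sigmoid (2 * π * x))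
      (sigmoid (2 * π * x) * (1 - sigmoid (2 * π * x)) * (2 * π)) Set.univ x := by
    intro x _
    have h := (hasDerivAt_sigmoid (2 * π * x)).comp x ((hasDerivAt_id x).const_mul (2 * π))
    simpa [Function.comp_def] using h
  have hinj : Set.InjOn (fun x : ℝ => sigmoid (2 * π * x)) Set.univ := by
    intro a _ b _ h
    exact mul_left_cancel₀ (by positivity : 2 * π ≠ 0) (sigmoid_injective h)
  have him : (fun x : ℝ => sigmoid (2 * π * x)) '' Set.univ = Set.Ioo 0 1 := by
    rw [Set.image_univ, ← range_sigmoid]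
    exact (mul_left_surjective₀ (by positivity : 2 * π ≠ 0)).range_comp sigmoid
  have hi := Complex.betaIntegral_convergent (u := 1 + Complex.I * z)
    (v := 1 - Complex.I * z) (by simp) (by simp)
  rw [intervalIntegrable_iff_integrableOn_Ioo_of_le zero_le_one, ← him,
    integrableOn_image_iff_integrableOn_abs_deriv_smul MeasurableSet.univ hd hinj,
    integrableOn_univ] at hi
  have hI := integral_image_eq_integral_abs_deriv_smul MeasurableSet.univ hd hinj
    (fun x : ℝ => (x : ℂ) ^ ((1 + Complex.I * z) - 1) * (1 - (x : ℂ)) ^ ((1 - Complex.I * z) - 1))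
  rw [him, ← integral_Ioc_eq_integral_Ioo, ← intervalIntegral.integral_of_le zero_le_one,
    setIntegral_univ] at hI
  change Complex.betaIntegral _ _ = _ at hI
  refine ⟨?_, ?_⟩
  · exact (hi.const_mul (2 / π : ℂ)).congr (Filter.Eventually.of_forall fun x => aux_point z x)
  · rw [← aux_beta z hz, hI, ← integral_const_mul]
    exact integral_congr_ae (Filter.Eventually.of_forall fun x => (aux_point z x).symm)
end

section
/- Fix integers ℓ and m > n ≥ 1. For every N ∈ ℕ₀ one has, as t → 0⁺, I_ℓ(t) = ∑_{r=0}^N a_r(m,n,ℓ)·t^r/r! + O(t^{N+1}). -/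
open Real MeasureTheory Filter Asymptotics

/-- For integers `ℓ` and `m > n ≥ 1` and real `t`, the integral
`I_ℓ(t) := ∫_ℝ e^{π(n−m)tu² − 2πiℓut} / cosh(πu)^n du`. -/
noncomputable def KWIntegral (m n : ℕ) (ℓ : ℤ) (t : ℝ) : ℂ :=
  ∫ u : ℝ, Complex.exp (π * ((n : ℂ) - m) * t * u ^ 2 - 2 * π * Complex.I * ℓ * u * t) /
      (Real.cosh (π * u) : ℂ) ^ n

/-- The moments `𝓔_{j,n} := ∫_ℝ x^j / cosh(πx)^n dx`. -/
noncomputable def coshMoment (j n : ℕ) : ℝ :=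
  ∫ x : ℝ, x ^ j / Real.cosh (π * x) ^ n

/-- The Taylor coefficients
`a_r(m,n,ℓ) := (−π)^r ∑_{k=0}^r binom(r,k) (m−n)^k (2iℓ)^{r−k} 𝓔_{k+r,n}`. -/
noncomputable def KWcoeff (m n : ℕ) (ℓ : ℤ) (r : ℕ) : ℂ :=
  (-(π : ℂ)) ^ r * ∑ k ∈ Finset.range (r + 1),
    (r.choose k : ℂ) * ((m : ℂ) - n) ^ k * (2 * Complex.I * ℓ) ^ (r - k) *
      (coshMoment (k + r) n : ℂ)

lemma kw_exp_bound (N : ℕ) (z : ℂ) (hz : z.re ≤ 0) :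
    ‖Complex.exp z - ∑ r ∈ Finset.range N, z ^ r / r.factorial‖ ≤ (N + 3) * ‖z‖ ^ N := by
  rcases le_total ‖z‖ 1 with h | h
  · have h1 := Complex.norm_exp_sub_sum_le_norm_mul_exp z N
    refine h1.trans ?_
    rw [mul_comm]
    have : Real.exp ‖z‖ ≤ 3 := (Real.exp_le_exp.2 h).trans Real.exp_one_lt_three.le
    have hN : (0 : ℝ) ≤ N := N.cast_nonneg
    gcongr
    linarith
  · have h1 : ‖Complex.exp z‖ ≤ ‖z‖ ^ N := by
      rw [Complex.norm_exp]
      exact (Real.exp_le_one_iff.2 hz).trans (one_le_pow₀ h)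
    have h2 : ‖∑ r ∈ Finset.range N, z ^ r / r.factorial‖ ≤ N * ‖z‖ ^ N := by
      refine (norm_sum_le _ _).trans ?_
      have : ∀ r ∈ Finset.range N, ‖z ^ r / (r.factorial : ℂ)‖ ≤ ‖z‖ ^ N := by
        intro r hr
        rw [norm_div, norm_pow, Complex.norm_natCast]
        refine (div_le_self (by positivity) (by exact_mod_cast r.factorial_pos)).trans ?_
        exact pow_le_pow_right₀ h (Finset.mem_range.1 hr).le
      simpa using Finset.sum_le_sum this
    have h3 := norm_sub_le (Complex.exp z) (∑ r ∈ Finset.range N, z ^ r / r.factorial)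
    have : 0 ≤ ‖z‖ ^ N := by positivity
    nlinarith

lemma kw_integrable (j n : ℕ) (h1 : 1 ≤ n) :
    Integrable (fun x : ℝ => x ^ j / Real.cosh (π * x) ^ n) := by
  have hc : ∀ x : ℝ, 0 < Real.cosh (π * x) := fun x => Real.cosh_pos _
  refine (integrable_inv_one_add_sq.const_mul
    (2 * (j.factorial + (j + 2).factorial : ℝ))).mono' ?_ (ae_of_all _ fun x => ?_)
  · refine Continuous.aestronglyMeasurable ?_
    refine Continuous.div (by fun_prop) ?_ fun x => (pow_pos (hc x) n).ne'
    exact (Real.continuous_cosh.comp (by fun_prop)).pow n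
  · have e1 : Real.exp |x| ≤ 2 * Real.cosh (π * x) := by
      rw [← Real.cosh_abs, Real.cosh_eq, abs_mul, abs_of_pos Real.pi_pos]
      have : Real.exp |x| ≤ Real.exp (π * |x|) := by
        apply Real.exp_le_exp.2
        nlinarith [abs_nonneg x, Real.pi_gt_three]
      have := Real.exp_pos (-(π * |x|))
      linarith
    have e2 : Real.cosh (π * x) ≤ Real.cosh (π * x) ^ n :=
      le_self_pow₀ (Real.one_le_cosh _) (by omega)
    have e3 : ∀ k : ℕ, |x| ^ k ≤ k.factorial * Real.exp |x| := fun k => by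
      have := Real.pow_div_factorial_le_exp |x| (abs_nonneg x) k
      rwa [div_le_iff₀ (by positivity), mul_comm] at this
    have a := e3 j
    have b := e3 (j + 2)
    rw [norm_div, norm_pow, norm_pow, Real.norm_eq_abs, Real.norm_eq_abs, abs_of_pos (hc x),
      ← div_eq_mul_inv, div_le_div_iff₀ (pow_pos (hc x) n) (by positivity)]
    calc |x| ^ j * (1 + x ^ 2) = |x| ^ j + |x| ^ (j + 2) := by rw [pow_add, sq_abs]; ring
      _ ≤ (j.factorial + (j + 2).factorial : ℝ) * Real.exp |x| := by linarith
      _ ≤ (j.factorial + (j + 2).factorial : ℝ) * (2 * Real.cosh (π * x) ^ n) := by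
        gcongr; linarith
      _ = _ := by ring

/-- the exponent divided by `t` -/
noncomputable def kwW (m n : ℕ) (ℓ : ℤ) (u : ℝ) : ℂ :=
  -(π : ℂ) * (((m : ℂ) - n) * u ^ 2 + 2 * Complex.I * ℓ * u)

lemma kwW_pow (m n : ℕ) (ℓ : ℤ) (r : ℕ) (u : ℝ) :
    kwW m n ℓ u ^ r / (Real.cosh (π * u) : ℂ) ^ n =
      (-(π : ℂ)) ^ r * ∑ k ∈ Finset.range (r + 1),
    (r.choose k : ℂ) * ((m : ℂ) - n) ^ k * (2 * Complex.I * ℓ) ^ (r - k) *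
      ((u ^ (k + r) / Real.cosh (π * u) ^ n : ℝ) : ℂ) := by
  rw [kwW, mul_pow, add_pow, mul_div_assoc, Finset.sum_div]
  congr 1
  refine Finset.sum_congr rfl fun k hk => ?_
  have hk' : k + r = 2 * k + (r - k) := by
    have := Finset.mem_range.1 hk
    omega
  rw [hk', mul_pow, mul_pow _ (u : ℂ), ← pow_mul, pow_add]
  push_cast
  ring

lemma kwW_integrable (m n : ℕ) (ℓ : ℤ) (h1 : 1 ≤ n) (r : ℕ) :
    Integrable (fun u : ℝ => kwW m n ℓ u ^ r / (Real.cosh (π * u) : ℂ) ^ n) := by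
  simp_rw [kwW_pow]
  refine Integrable.const_mul (integrable_finsetSum _ fun k _ => ?_) _
  exact ((kw_integrable (k + r) n h1).ofReal).const_mul _

lemma kwW_integral (m n : ℕ) (ℓ : ℤ) (h1 : 1 ≤ n) (r : ℕ) :
    ∫ u : ℝ, kwW m n ℓ u ^ r / (Real.cosh (π * u) : ℂ) ^ n = KWcoeff m n ℓ r := by
  simp_rw [kwW_pow]
  rw [integral_const_mul, integral_finsetSum _ fun k _ =>
    ((kw_integrable (k + r) n h1).ofReal).const_mul _]
  simp_rw [integral_const_mul, integral_complex_ofReal]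
  rfl

lemma kwW_cont (m n : ℕ) (ℓ : ℤ) : Continuous (kwW m n ℓ) := by
  unfold kwW; fun_prop

lemma kw_re (m n : ℕ) (ℓ : ℤ) (h2 : n < m) (t u : ℝ) (ht : 0 < t) :
    ((t : ℂ) * kwW m n ℓ u).re ≤ 0 := by
  have : (t : ℂ) * kwW m n ℓ u = ((-(t * π * ((m : ℝ) - n) * u ^ 2) : ℝ) : ℂ) +
      ((-(t * π * 2 * ℓ * u) : ℝ) : ℂ) * Complex.I := by
    unfold kwW; push_cast; ring
  rw [this, Complex.add_re, Complex.ofReal_re, Complex.re_ofReal_mul, Complex.I_re]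
  have : (0 : ℝ) < (m : ℝ) - n := sub_pos.2 (by exact_mod_cast h2)
  have : 0 ≤ t * π * ((m : ℝ) - n) * u ^ 2 := by positivity
  linarith

/-- Fix integers `ℓ` and `m > n ≥ 1`. For every `N ∈ ℕ₀` one has, as `t → 0⁺`,
`I_ℓ(t) = ∑_{r=0}^N a_r(m,n,ℓ)·t^r/r! + O(t^{N+1})`. -/
theorem stmt_5 (ℓ : ℤ) (m n : ℕ) (h1 : 1 ≤ n) (h2 : n < m) (N : ℕ) :
    (fun t : ℝ => KWIntegral m n ℓ t -
        ∑ r ∈ Finset.range (N + 1), KWcoeff m n ℓ r * t ^ r / r.factorial)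
      =O[nhdsWithin 0 (Set.Ioi 0)] (fun t : ℝ => t ^ (N + 1)) := by
  refine IsBigO.of_bound (((N + 1 : ℕ) + 3) *
    ∫ u : ℝ, ‖kwW m n ℓ u ^ (N + 1) / (Real.cosh (π * u) : ℂ) ^ n‖) ?_
  filter_upwards [self_mem_nhdsWithin] with t ht
  have ht : 0 < t := ht
  have hcc : Continuous fun u : ℝ => (Real.cosh (π * u) : ℂ) ^ n :=
    (Complex.continuous_ofReal.comp (Real.continuous_cosh.comp (by fun_prop))).pow n
  have hc0 : ∀ u : ℝ, (Real.cosh (π * u) : ℂ) ^ n ≠ 0 := fun u =>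
    pow_ne_zero _ (Complex.ofReal_ne_zero.2 (Real.cosh_pos _).ne')
  have hI : KWIntegral m n ℓ t =
      ∫ u : ℝ, Complex.exp (t * kwW m n ℓ u) / (Real.cosh (π * u) : ℂ) ^ n := by
    unfold KWIntegral kwW
    congr 1; ext u; congr 2; ring
  have hEi : Integrable fun u : ℝ =>
      Complex.exp (t * kwW m n ℓ u) / (Real.cosh (π * u) : ℂ) ^ n := by
    refine (kwW_integrable m n ℓ h1 0).mono ?_ (ae_of_all _ fun u => ?_)
    · refine Continuous.aestronglyMeasurable (Continuous.div ?_ hcc hc0)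
      exact Complex.continuous_exp.comp (continuous_const.mul (kwW_cont m n ℓ))
    · rw [norm_div, norm_div, Complex.norm_exp, pow_zero, norm_one]
      gcongr
      exact Real.exp_le_one_iff.2 (kw_re m n ℓ h2 t u ht)
  have hTi : ∀ r ∈ Finset.range (N + 1), Integrable fun u : ℝ =>
      ((t : ℂ) ^ r / r.factorial) * (kwW m n ℓ u ^ r / (Real.cosh (π * u) : ℂ) ^ n) :=
    fun r _ => (kwW_integrable m n ℓ h1 r).const_mul _
  have hS : ∑ r ∈ Finset.range (N + 1), KWcoeff m n ℓ r * t ^ r / r.factorial =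
      ∫ u : ℝ, ∑ r ∈ Finset.range (N + 1),
        ((t : ℂ) ^ r / r.factorial) * (kwW m n ℓ u ^ r / (Real.cosh (π * u) : ℂ) ^ n) := by
    rw [integral_finsetSum _ hTi]
    refine Finset.sum_congr rfl fun r _ => ?_
    rw [integral_const_mul, kwW_integral m n ℓ h1]
    ring
  rw [hI, hS, ← integral_sub hEi (integrable_finsetSum _ hTi), mul_right_comm,
    ← integral_const_mul]
  refine norm_integral_le_of_norm_le ((kwW_integrable m n ℓ h1 (N + 1)).norm.const_mul _)
    (ae_of_all _ fun u => ?_)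
  have key := kw_exp_bound (N + 1) (t * kwW m n ℓ u) (kw_re m n ℓ h2 t u ht)
  have : Complex.exp (t * kwW m n ℓ u) / (Real.cosh (π * u) : ℂ) ^ n -
      ∑ r ∈ Finset.range (N + 1),
        ((t : ℂ) ^ r / r.factorial) * (kwW m n ℓ u ^ r / (Real.cosh (π * u) : ℂ) ^ n) =
      (Complex.exp (t * kwW m n ℓ u) -
        ∑ r ∈ Finset.range (N + 1), (t * kwW m n ℓ u) ^ r / r.factorial) /
        (Real.cosh (π * u) : ℂ) ^ n := by
    rw [sub_div, Finset.sum_div]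
    congr 1
    refine Finset.sum_congr rfl fun r _ => ?_
    rw [mul_pow]; ring
  rw [this, norm_div, norm_div, ← mul_div_assoc]
  refine div_le_div_of_nonneg_right (key.trans (le_of_eq ?_)) (norm_nonneg _)
  rw [norm_mul, mul_pow, norm_pow, norm_pow, Complex.norm_real]
  ring
end

section
/- Fix integers ℓ and m > n ≥ 1, and for t > 0 define Φ_ℓ(t) := ∫_{−1/2}^{1/2} (−1)^m i^{−n} e^{πi(m−n)u} e^{−π(m−n)t/3 + πt/12} η(it)^{1+n−m} · ϑ(u + 1/2 + it/2; it)^m · ϑ(u + it/2; it)^{−n} · e^{−2πiℓu} du (this is the specialized Kac–Wakimoto character tr_{L_{m,n}(Λ_{(ℓ)})} q^{L₀} at τ = it). Then for every N ∈ ℕ₀, as t → 0⁺, Φ_ℓ(t) = e^{πt(n−m+1)/12 + π(m+2n−1)/(12t)} · (√t/2^n) · ( ∑_{r=0}^N a_r(m,n,ℓ) t^r/r! + O(t^{N+1}) ). -/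
open Real

/-- The Jacobi theta function
`ϑ(z;τ) := ∑_{ν ∈ 1/2 + ℤ} e^{πiν²τ + 2πiν(z+1/2)}`, parametrized by `ν = n + 1/2, n ∈ ℤ`. -/
noncomputable def jacobiThetaKW (z τ : ℂ) : ℂ :=
  ∑' n : ℤ, Complex.exp (π * Complex.I * ((n : ℂ) + 1 / 2) ^ 2 * τ +
      2 * π * Complex.I * ((n : ℂ) + 1 / 2) * (z + 1 / 2))

/-- The Dedekind eta function `η(τ) := q^{1/24} ∏_{k=1}^∞ (1 − q^k)`, `q = e^{2πiτ}`. -/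
noncomputable def dedekindEta (τ : ℂ) : ℂ :=
  Complex.exp (π * Complex.I * τ / 12) *
    ∏' k : ℕ, (1 - Complex.exp (2 * π * Complex.I * τ * ((k : ℂ) + 1)))

/-- The specialized Kac-Wakimoto character `tr_{L_{m,n}(Λ_{(ℓ)})} q^{L₀}` at `τ = it`:
`Φ_ℓ(t) := ∫_{−1/2}^{1/2} (−1)^m i^{−n} e^{πi(m−n)u} e^{−π(m−n)t/3 + πt/12} η(it)^{1+n−m}
  ϑ(u + 1/2 + it/2; it)^m ϑ(u + it/2; it)^{−n} e^{−2πiℓu} du`. -/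
noncomputable def KWchar (m n : ℕ) (ℓ : ℤ) (t : ℝ) : ℂ :=
  ∫ u in (-(1 / 2) : ℝ)..(1 / 2),
    (-1) ^ m * Complex.I ^ (-(n : ℤ)) * Complex.exp (π * Complex.I * ((m : ℂ) - n) * u) *
      Complex.exp (-π * ((m : ℂ) - n) * t / 3 + π * t / 12) *
      dedekindEta (Complex.I * t) ^ (1 + (n : ℤ) - m) *
      jacobiThetaKW ((u : ℂ) + 1 / 2 + Complex.I * t / 2) (Complex.I * t) ^ m *
      jacobiThetaKW ((u : ℂ) + Complex.I * t / 2) (Complex.I * t) ^ (-(n : ℤ)) *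
      Complex.exp (-2 * π * Complex.I * ℓ * u)

namespace KW
open Complex in
lemma theta_shift (v t : ℝ) (ht : 0 < t) :
    jacobiThetaKW ((v : ℂ) - 1 / 2 + Complex.I * t / 2) (Complex.I * t) =
      Complex.exp (π * t / 4) * Complex.exp (-(π * Complex.I * v)) *
        (HurwitzZeta.cosKernel (v : UnitAddCircle) t : ℂ) := by
  have h := (HurwitzZeta.hasSum_int_cosKernel v ht)
  have h2 := ((Equiv.addRight (1 : ℤ)).hasSum_iff.mpr h).mul_left
    (Complex.exp (π * t / 4) * Complex.exp (-(π * Complex.I * v)))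
  rw [← h2.tsum_eq, jacobiThetaKW]
  congr 1
  ext k
  simp only [Function.comp, Equiv.coe_addRight]
  push_cast
  rw [← Complex.exp_add, ← Complex.exp_add, ← Complex.exp_add]
  congr 1
  linear_combination (π * (k + 1 / 2) ^ 2 * t + π * (k + 1 / 2) * t) * Complex.I_sq

lemma theta3 (u t : ℝ) (ht : 0 < t) :
    jacobiThetaKW ((u : ℂ) + 1 / 2 + Complex.I * t / 2) (Complex.I * t) =
      -(Complex.exp (π * t / 4) * Complex.exp (-(π * Complex.I * u)) *
        (HurwitzZeta.cosKernel (u : UnitAddCircle) t : ℂ)) := by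
  have h := theta_shift (u + 1) t ht
  have e : ((u + 1 : ℝ) : UnitAddCircle) = (u : UnitAddCircle) := by
    rw [AddCircle.coe_add]; simp
  rw [e] at h
  have e2 : Complex.exp (-(π * Complex.I * ((u + 1 : ℝ) : ℂ))) =
      - Complex.exp (-(π * Complex.I * u)) := by
    push_cast
    rw [show -(π * Complex.I * ((u : ℂ) + 1)) = -(π * Complex.I * u) - π * Complex.I by ring,
      Complex.exp_sub, Complex.exp_pi_mul_I]
    ring
  rw [e2] at h
  rw [show (u : ℂ) + 1 / 2 + Complex.I * t / 2 = ((u + 1 : ℝ) : ℂ) - 1 / 2 + Complex.I * t / 2 by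
    push_cast; ring, h]
  ring

lemma theta4 (u t : ℝ) (ht : 0 < t) :
    jacobiThetaKW ((u : ℂ) + Complex.I * t / 2) (Complex.I * t) =
      -Complex.I * (Complex.exp (π * t / 4) * Complex.exp (-(π * Complex.I * u)) *
        (HurwitzZeta.cosKernel ((u + 1 / 2 : ℝ) : UnitAddCircle) t : ℂ)) := by
  have h := theta_shift (u + 1 / 2) t ht
  have e2 : Complex.exp (-(π * Complex.I * ((u + 1 / 2 : ℝ) : ℂ))) =
      -Complex.I * Complex.exp (-(π * Complex.I * u)) := by
    push_cast
    rw [show -(π * Complex.I * ((u : ℂ) + 1 / 2)) = -(π * Complex.I * u) - π / 2 * Complex.I by ring,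
      Complex.exp_sub, Complex.exp_pi_div_two_mul_I]
    rw [Complex.div_I]; ring
  rw [e2] at h
  rw [show (u : ℂ) + Complex.I * t / 2 = ((u + 1 / 2 : ℝ) : ℂ) - 1 / 2 + Complex.I * t / 2 by
    push_cast; ring, h]
  ring

/-- the Euler product -/
noncomputable def PP (q : ℂ) : ℂ := ∏' k : ℕ, (1 - q ^ (k + 1))

lemma eta_eq (τ : ℂ) : dedekindEta τ = ModularForm.eta τ := by
  rw [dedekindEta, ModularForm.eta]
  congr 1
  · rw [Function.Periodic.qParam]; congr 1; push_cast; ring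
  · congr 1; ext k; rw [ModularForm.eta_q_eq_cexp]; congr 2; ring

lemma eta_val (s : ℝ) : ModularForm.eta (Complex.I * s) =
    Complex.exp (-(π * s / 12)) * PP (Complex.exp (-(2 * π * s))) := by
  rw [ModularForm.eta, PP]
  congr 1
  · rw [Function.Periodic.qParam]; congr 1; push_cast
    linear_combination (2 * π * s / 24) * Complex.I_sq
  · congr 1; ext k; rw [ModularForm.eta_q_eq_pow]; congr 3
    linear_combination (2 * π * s) * Complex.I_sq

lemma eta_S (t : ℝ) (ht : 0 < t) : dedekindEta (Complex.I * t) =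
    ((Real.sqrt t : ℝ) : ℂ)⁻¹ * Complex.exp (-(π / (12 * t))) *
      PP (Complex.exp (-(2 * π / t))) := by
  have h := ModularForm.eta_comp_eq_csqrt_I_inv
    (show Complex.I * t ∈ UpperHalfPlane.upperHalfPlaneSet by
      simp [UpperHalfPlane.upperHalfPlaneSet, ht])
  simp only [Function.comp, Pi.smul_apply, Pi.mul_apply, smul_eq_mul] at h
  have htc : (t : ℂ) ≠ 0 := by exact_mod_cast ht.ne'
  have e1 : -1 / (Complex.I * t) = Complex.I * ((1 / t : ℝ) : ℂ) := by
    push_cast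
    field_simp
    simp
  have e2 : Complex.sqrt (Complex.I * t) = Complex.sqrt Complex.I * (Real.sqrt t : ℝ) := by
    rw [sqrt_eq_exp (by simp [htc]), sqrt_eq_exp Complex.I_ne_zero, mul_comm,
      Complex.log_ofReal_mul ht Complex.I_ne_zero, Real.sqrt_eq_rpow, Real.rpow_def_of_pos ht]
    push_cast
    rw [← Complex.exp_add]
    congr 1
    ring
  rw [e1, eta_val, e2] at h
  rw [eta_eq]
  have hI : Complex.sqrt Complex.I ≠ 0 := by
    simp [Complex.sqrt]
  have hR : ((Real.sqrt t : ℝ) : ℂ) ≠ 0 := by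
    exact_mod_cast (Real.sqrt_pos.mpr ht).ne'
  have h3 : -(π * ((1 / t : ℝ) : ℂ) / 12) = -(π / (12 * t)) := by push_cast; field_simp
  have h4 : -(2 * π * ((1 / t : ℝ) : ℂ)) = -(2 * π / t) := by push_cast; field_simp
  rw [h3, h4] at h
  rw [mul_assoc, h]
  field_simp
end KW
namespace KW
/-- normalised theta_3 -/
noncomputable def AA (t x : ℝ) : ℝ :=
  Real.sqrt t * Real.exp (π * t * x ^ 2) * HurwitzZeta.cosKernel ((t * x : ℝ) : UnitAddCircle) t

/-- normalised theta_4 -/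
noncomputable def BB (t x : ℝ) : ℝ :=
  Real.sqrt t * Real.exp (π * t * x ^ 2 + π / (4 * t)) *
    HurwitzZeta.cosKernel ((t * x + 1 / 2 : ℝ) : UnitAddCircle) t / (2 * Real.cosh (π * x))

lemma even_eq (a : UnitAddCircle) (t : ℝ) (ht : 0 < t) :
    HurwitzZeta.evenKernel a (1 / t) = Real.sqrt t * HurwitzZeta.cosKernel a t := by
  rw [HurwitzZeta.evenKernel_functional_equation, Real.sqrt_eq_rpow, one_div_one_div,
    Real.div_rpow zero_le_one ht.le, Real.one_rpow, one_div_one_div]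

lemma hasSum_AA (t x : ℝ) (ht : 0 < t) :
    HasSum (fun k : ℤ => Real.exp (-π * k ^ 2 / t - 2 * π * k * x)) (AA t x) := by
  have h := (HurwitzZeta.hasSum_int_evenKernel (t * x) (one_div_pos.mpr ht)).mul_left
    (Real.exp (π * t * x ^ 2))
  rw [even_eq _ t ht] at h
  rw [show AA t x = Real.exp (π * t * x ^ 2) * (Real.sqrt t *
    HurwitzZeta.cosKernel ((t * x : ℝ) : UnitAddCircle) t) by rw [AA]; ring]
  refine (congrArg (fun f => HasSum f _) (funext fun k => ?_)).mpr h
  rw [← Real.exp_add]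
  congr 1
  field_simp
  ring

lemma hasSum_BB (t x : ℝ) (ht : 0 < t) :
    HasSum (fun k : ℕ => Real.exp (-π * (k ^ 2 + k) / t) *
      (Real.cosh ((2 * k + 1) * (π * x)) / Real.cosh (π * x))) (BB t x) := by
  have h := ((HurwitzZeta.hasSum_int_evenKernel (t * x + 1 / 2) (one_div_pos.mpr ht)).mul_left
    (Real.exp (π * t * x ^ 2 + π / (4 * t)) / (2 * Real.cosh (π * x)))).nat_add_neg_add_one
  rw [even_eq _ t ht] at h
  rw [show BB t x = Real.exp (π * t * x ^ 2 + π / (4 * t)) / (2 * Real.cosh (π * x)) *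
    (Real.sqrt t * HurwitzZeta.cosKernel ((t * x + 1 / 2 : ℝ) : UnitAddCircle) t) by rw [BB]; ring]
  refine (congrArg (fun f => HasSum f _) (funext fun k => ?_)).mpr h
  · have hc := (Real.cosh_pos (π * x)).ne'
    rw [Real.cosh_eq ((2 * k + 1) * (π * x))]
    have e1 : Real.exp (-π * (k ^ 2 + k) / t) * Real.exp ((2 * k + 1) * (π * x)) =
      Real.exp (π * t * x ^ 2 + π / (4 * t)) *
      Real.exp (-π * (((-((k : ℤ) + 1) : ℤ) : ℝ) + (t * x + 1 / 2)) ^ 2 * (1 / t)) := by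
      rw [← Real.exp_add, ← Real.exp_add]
      congr 1
      push_cast
      field_simp
      ring
    have e2 : Real.exp (-π * (k ^ 2 + k) / t) * Real.exp (-((2 * k + 1) * (π * x))) =
      Real.exp (π * t * x ^ 2 + π / (4 * t)) *
      Real.exp (-π * (((k : ℤ) : ℝ) + (t * x + 1 / 2)) ^ 2 * (1 / t)) := by
      rw [← Real.exp_add, ← Real.exp_add]
      congr 1
      push_cast
      field_simp
      ring
    calc _ = (Real.exp (-π * (k ^ 2 + k) / t) * Real.exp ((2 * k + 1) * (π * x)) +
        Real.exp (-π * (k ^ 2 + k) / t) * Real.exp (-((2 * k + 1) * (π * x)))) /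
          (2 * Real.cosh (π * x)) := by field_simp
      _ = _ := by rw [e1, e2]; ring

/-- constant -/
noncomputable def C0 : ℝ := ∑' k : ℤ, Real.exp (-π * (|(k : ℝ)| - 1))

lemma summable_C0 : Summable (fun k : ℤ => Real.exp (-π * (|(k : ℝ)| - 1))) := by
  have h : Summable (fun k : ℕ => Real.exp (-π * ((k : ℝ) - 1))) := by
    have : Summable (fun k : ℕ => Real.exp π * (Real.exp (-π)) ^ k) := by
      apply Summable.mul_left
      apply summable_geometric_of_lt_one (Real.exp_pos _).le
      rw [Real.exp_lt_one_iff]; linarith [Real.pi_pos]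
    convert this using 2 with k
    rw [← Real.exp_nat_mul, ← Real.exp_add]; congr 1; ring
  apply Summable.of_nat_of_neg
  · simpa using h
  · simpa using h

lemma AA_bound (t x : ℝ) (ht : 0 < t) (ht1 : t ≤ 1) (hx : |x| ≤ 1 / (2 * t)) :
    |AA t x - 1| ≤ C0 * Real.exp (-π / t + 2 * π * |x|) := by
  have h := (hasSum_AA t x ht)
  have h0 : HasSum (fun k : ℤ => if k = 0 then (1 : ℝ) else 0) 1 := by
    simpa using hasSum_ite_eq (0 : ℤ) (1 : ℝ)
  have h1 := h.sub h0
  rw [← h1.tsum_eq, ← Real.norm_eq_abs]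
  refine tsum_of_norm_bounded (summable_C0.hasSum.mul_right _) ?_
  intro k
  by_cases hk : k = 0
  · subst hk; simp; positivity
  · simp only [hk, if_false, sub_zero, Real.norm_eq_abs, Real.abs_exp]
    rw [← Real.exp_add, Real.exp_le_exp]
    have hj : (1 : ℝ) ≤ |(k : ℝ)| := by exact_mod_cast Int.one_le_abs hk
    have hs : 1 ≤ 1 / t := by rw [le_div_iff₀ ht]; linarith
    have hxs : 2 * |x| ≤ 1 / t := by
      have : 1 / (2 * t) = (1 / t) / 2 := by field_simp
      linarith
    have e : -π * (k : ℝ) ^ 2 / t = -π * (|(k : ℝ)| ^ 2 * (1 / t)) := by rw [sq_abs]; ring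
    have e' : -π / t = -π * (1 / t) := by ring
    rw [e, e']
    have hkx : -(k * x) ≤ |(k : ℝ)| * |x| := by rw [← abs_mul]; exact neg_le_abs _
    generalize |(k : ℝ)| = j at *
    generalize 1 / t = s at *
    have key : -(j ^ 2 * s) + 2 * (j * |x|) ≤ -(j - 1) + (-s + 2 * |x|) := by
      have : (j - 1) * (2 * |x|) ≤ (j - 1) * s := mul_le_mul_of_nonneg_left hxs (by linarith)
      have : (j - 1) * 1 ≤ (j - 1) * (s * j) :=
        mul_le_mul_of_nonneg_left (by nlinarith) (by linarith)
      nlinarith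
    nlinarith [Real.pi_pos, mul_le_mul_of_nonneg_left key Real.pi_pos.le, mul_le_mul_of_nonneg_left hkx Real.pi_pos.le]

lemma cosh_ratio (k : ℕ) (y : ℝ) :
    Real.cosh ((2 * k + 1) * y) / Real.cosh y ≤ 2 * Real.exp (2 * k * |y|) := by
  rw [div_le_iff₀ (Real.cosh_pos _), ← Real.cosh_abs y, ← Real.cosh_abs ((2 * k + 1) * y), abs_mul,
    abs_of_pos (by positivity : (0 : ℝ) < 2 * k + 1)]
  have h1 : Real.cosh ((2 * k + 1) * |y|) ≤ Real.exp ((2 * k + 1) * |y|) := by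
    rw [Real.cosh_eq]
    have : Real.exp (-((2 * k + 1) * |y|)) ≤ Real.exp ((2 * k + 1) * |y|) := by
      rw [Real.exp_le_exp]
      have : 0 ≤ (2 * k + 1) * |y| := by positivity
      linarith
    linarith
  have h2 : Real.exp |y| ≤ 2 * Real.cosh |y| := by
    rw [Real.cosh_eq]; linarith [Real.exp_pos (-|y|)]
  calc _ ≤ _ := h1
    _ = Real.exp (2 * k * |y|) * Real.exp |y| := by rw [← Real.exp_add]; congr 1; ring
    _ ≤ Real.exp (2 * k * |y|) * (2 * Real.cosh |y|) := by gcongr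
    _ = _ := by ring

lemma summable_C1 : Summable (fun k : ℕ => 2 * Real.exp (-π * ((k : ℝ) - 1))) := by
  have := summable_C0.comp_injective (Nat.cast_injective (R := ℤ))
  apply Summable.mul_left
  simpa [Function.comp_def] using this

/-- constant -/
noncomputable def C1 : ℝ := ∑' k : ℕ, 2 * Real.exp (-π * ((k : ℝ) - 1))

lemma BB_bound (t x : ℝ) (ht : 0 < t) (ht1 : t ≤ 1) (hx : |x| ≤ 1 / (2 * t)) :
    |BB t x - 1| ≤ C1 * Real.exp (-π / t + 2 * π * |x|) := by
  have h := (hasSum_BB t x ht)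
  have h0 : HasSum (fun k : ℕ => if k = 0 then (1 : ℝ) else 0) 1 := by
    simpa using hasSum_ite_eq (0 : ℕ) (1 : ℝ)
  have h1 := h.sub h0
  rw [← h1.tsum_eq, ← Real.norm_eq_abs]
  refine tsum_of_norm_bounded (summable_C1.hasSum.mul_right _) ?_
  intro k
  by_cases hk : k = 0
  · subst hk
    simp only [Nat.cast_zero, mul_zero, zero_add, one_mul]
    rw [div_self (Real.cosh_pos _).ne']
    simp; positivity
  · simp only [hk, if_false, sub_zero, Real.norm_eq_abs]
    rw [abs_of_nonneg (by have := Real.cosh_pos (π * x); have := Real.cosh_pos ((2 * k + 1) * (π * x)); positivity)]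
    refine (mul_le_mul_of_nonneg_left (cosh_ratio k _) (Real.exp_pos _).le).trans ?_
    rw [mul_left_comm, mul_assoc 2 (Real.exp _) (Real.exp _), ← Real.exp_add, ← Real.exp_add]
    refine mul_le_mul_of_nonneg_left (Real.exp_le_exp.mpr ?_) zero_le_two
    have hj : (1 : ℝ) ≤ k := by exact_mod_cast Nat.one_le_iff_ne_zero.mpr hk
    have hs : 1 ≤ 1 / t := by rw [le_div_iff₀ ht]; linarith
    have hxs : 2 * |x| ≤ 1 / t := by
      have : 1 / (2 * t) = (1 / t) / 2 := by field_simp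
      linarith
    have e : -π * ((k : ℝ) ^ 2 + k) / t = -π * (((k : ℝ) ^ 2 + k) * (1 / t)) := by ring
    have e' : -π / t = -π * (1 / t) := by ring
    rw [e, e', abs_mul, abs_of_pos Real.pi_pos]
    generalize (k : ℝ) = j at *
    generalize 1 / t = s at *
    have key : -((j ^ 2 + j) * s) + 2 * (j * |x|) ≤ -(j - 1) + (-s + 2 * |x|) := by
      have : (j - 1) * (2 * |x|) ≤ (j - 1) * s := mul_le_mul_of_nonneg_left hxs (by linarith)
      have : (j - 1) * 1 ≤ (j - 1) * (s * j) :=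
        mul_le_mul_of_nonneg_left (by nlinarith) (by linarith)
      nlinarith
    nlinarith [Real.pi_pos, mul_le_mul_of_nonneg_left key Real.pi_pos.le]

lemma BB_ge (t x : ℝ) (ht : 0 < t) : 1 ≤ BB t x := by
  have h := (hasSum_BB t x ht)
  have := h.summable.le_tsum 0 (fun k _ => by
    have := Real.cosh_pos (π * x); have := Real.cosh_pos ((2 * k + 1) * (π * x)); positivity)
  rw [h.tsum_eq] at this
  simpa [div_self (Real.cosh_pos (π * x)).ne'] using this

lemma cont_cos (t : ℝ) (ht : 0 < t) :
    Continuous (fun u : ℝ => HurwitzZeta.cosKernel (u : UnitAddCircle) t) := by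
  have : (fun u : ℝ => HurwitzZeta.cosKernel (u : UnitAddCircle) t) =
      fun u : ℝ => (jacobiTheta₂ u (Complex.I * t)).re := by
    ext u; rw [← HurwitzZeta.cosKernel_def]; simp
  rw [this]
  refine Complex.continuous_re.comp (continuous_iff_continuousAt.mpr fun u => ?_)
  exact ((differentiableAt_jacobiTheta₂_fst (u : ℂ) (by simpa using ht)).continuousAt).comp
    (Complex.continuous_ofReal.continuousAt)

lemma cont_AA (t : ℝ) (ht : 0 < t) : Continuous (AA t) := by
  unfold AA
  have := (cont_cos t ht).comp (by fun_prop : Continuous fun x : ℝ => t * x)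
  simp only [Function.comp_def] at this
  fun_prop

lemma cont_BB (t : ℝ) (ht : 0 < t) : Continuous (BB t) := by
  unfold BB
  have := (cont_cos t ht).comp (by fun_prop : Continuous fun x : ℝ => t * x + 1 / 2)
  simp only [Function.comp_def] at this
  refine Continuous.div (by fun_prop) (by fun_prop) (fun x => ?_)
  have := Real.cosh_pos (π * x)
  positivity
end KW
namespace KW
/-- phase exponent -/
noncomputable def zz (d : ℝ) (ℓ : ℤ) (t x : ℝ) : ℂ :=
  -(π : ℂ) * t * ((d : ℂ) * (x : ℂ) ^ 2 + 2 * Complex.I * ℓ * x)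

/-- rescaled integrand -/
noncomputable def gg (p n : ℕ) (ℓ : ℤ) (t x : ℝ) : ℂ :=
  ((PP (Complex.exp (-(2 * π / t)))) ^ p)⁻¹ * Complex.exp (zz (p + 1) ℓ t x) *
    ((AA t x : ℂ) ^ (n + 1 + p) * ((BB t x : ℂ)⁻¹) ^ n) / (Real.cosh (π * x) : ℂ) ^ n

lemma alg1 (p n : ℕ) (X Y R G c a b e f P E1 L : ℂ) (hX : X ≠ 0) (hY : Y ≠ 0) (hR : R ≠ 0)
    (hG : G ≠ 0) (hE : E1 * Y ^ (p + 1) = L) :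
    (-1) ^ (n + 1 + p) * (Complex.I ^ n)⁻¹ * (X⁻¹) ^ (p + 1) * E1 *
      ((R⁻¹ * e * P) ^ p)⁻¹ * (-(Y * X * (a * G / R))) ^ (n + 1 + p) *
      ((-Complex.I * (Y * X * (2 * c * b * G * f / R))) ^ n)⁻¹ =
    L * ((e ^ p)⁻¹ * (f ^ n)⁻¹) * (R⁻¹ / 2 ^ n) *
      ((P ^ p)⁻¹ * G ^ (p + 1) * (a ^ (n + 1 + p) * (b⁻¹) ^ n) / c ^ n) := by
  subst hE
  have h1 : (-(Y * X * (a * G / R))) ^ (n + 1 + p) =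
      (-1) ^ (n + 1 + p) * (Y ^ n * Y ^ (p + 1)) * (X ^ n * X ^ (p + 1)) * a ^ (n + 1 + p) *
        (G ^ n * G ^ (p + 1)) * (R ^ n * R * R ^ p)⁻¹ := by
    rw [neg_eq_neg_one_mul, mul_pow]
    simp only [mul_pow, mul_inv, div_eq_mul_inv, inv_pow, pow_add, pow_one]
    ring
  have h2 : ((-1 : ℂ)) ^ (n + 1 + p) * (-1) ^ (n + 1 + p) = 1 := by
    rw [← mul_pow]; simp
  have h3 : (-Complex.I) ^ n * Complex.I ^ n = 1 := by
    rw [← mul_pow]; simp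
  have h4 : (Complex.I ^ n)⁻¹ * ((-Complex.I) ^ n)⁻¹ = 1 := by
    rw [← mul_inv, mul_comm (Complex.I ^ n), h3, inv_one]
  have h5 : ((-Complex.I * (Y * X * (2 * c * b * G * f / R))) ^ n)⁻¹ =
      ((-Complex.I) ^ n)⁻¹ * (Y ^ n)⁻¹ * (X ^ n)⁻¹ * (2 ^ n)⁻¹ * (c ^ n)⁻¹ * (b⁻¹) ^ n *
        (G ^ n)⁻¹ * (f ^ n)⁻¹ * R ^ n := by
    simp only [mul_pow, mul_inv, inv_pow, div_eq_mul_inv, inv_inv]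
    ring
  have h6 : ((R⁻¹ * e * P) ^ p)⁻¹ = R ^ p * (e ^ p)⁻¹ * (P ^ p)⁻¹ := by
    simp only [mul_pow, mul_inv, inv_pow, inv_inv]
  rw [h1, h5, h6]
  calc _ = (((-1 : ℂ)) ^ (n + 1 + p) * (-1) ^ (n + 1 + p)) *
        ((Complex.I ^ n)⁻¹ * ((-Complex.I) ^ n)⁻¹) *
        ((X⁻¹) ^ (p + 1) * X ^ (p + 1)) * (X ^ n * (X ^ n)⁻¹) * (Y ^ n * (Y ^ n)⁻¹) *
        (G ^ n * (G ^ n)⁻¹) * ((R ^ n * (R ^ n)⁻¹) * (R ^ p * (R ^ p)⁻¹)) *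
        (E1 * Y ^ (p + 1) * ((e ^ p)⁻¹ * (f ^ n)⁻¹) * (R⁻¹ / 2 ^ n) *
      ((P ^ p)⁻¹ * G ^ (p + 1) * (a ^ (n + 1 + p) * (b⁻¹) ^ n) / c ^ n)) := by
        simp only [mul_inv, div_eq_mul_inv]; ring
    _ = _ := by
        rw [h2, h4, ← mul_pow, inv_mul_cancel₀ hX, one_pow,
          mul_inv_cancel₀ (pow_ne_zero _ hX), mul_inv_cancel₀ (pow_ne_zero _ hY),
          mul_inv_cancel₀ (pow_ne_zero _ hG), mul_inv_cancel₀ (pow_ne_zero _ hR),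
          mul_inv_cancel₀ (pow_ne_zero _ hR)]
        ring

lemma integrand_eq (ℓ : ℤ) (p n : ℕ) (t u : ℝ) (ht : 0 < t) :
    (-1) ^ (n + 1 + p) * Complex.I ^ (-(n : ℤ)) *
      Complex.exp (π * Complex.I * (((n + 1 + p : ℕ) : ℂ) - n) * u) *
      Complex.exp (-π * (((n + 1 + p : ℕ) : ℂ) - n) * t / 3 + π * t / 12) *
      dedekindEta (Complex.I * t) ^ (1 + (n : ℤ) - (n + 1 + p : ℕ)) *
      jacobiThetaKW ((u : ℂ) + 1 / 2 + Complex.I * t / 2) (Complex.I * t) ^ (n + 1 + p) *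
      jacobiThetaKW ((u : ℂ) + Complex.I * t / 2) (Complex.I * t) ^ (-(n : ℤ)) *
      Complex.exp (-2 * π * Complex.I * ℓ * u) =
    ((Real.exp (π * t * ((n : ℝ) - (n + 1 + p : ℕ) + 1) / 12 +
        π * (((n + 1 + p : ℕ) : ℝ) + 2 * n - 1) / (12 * t)) : ℝ) : ℂ) *
      (((Real.sqrt t : ℝ) : ℂ)⁻¹ / 2 ^ n) * gg p n ℓ t (u / t) := by
  have htc : (t : ℂ) ≠ 0 := by exact_mod_cast ht.ne'
  have hR : ((Real.sqrt t : ℝ) : ℂ) ≠ 0 := by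
    exact_mod_cast (Real.sqrt_pos.mpr ht).ne'
  have hux : t * (u / t) = u := by field_simp
  have hA : (HurwitzZeta.cosKernel (u : UnitAddCircle) t : ℂ) =
      (AA t (u / t) : ℂ) * Complex.exp (-(π * u ^ 2 / t)) / (Real.sqrt t : ℝ) := by
    rw [AA, hux]
    have : (Real.exp (π * t * (u / t) ^ 2) : ℂ) * Complex.exp (-(π * u ^ 2 / t)) = 1 := by
      push_cast
      rw [← Complex.exp_add, ← Complex.exp_zero]; congr 1; field_simp; ring
    rw [Complex.ofReal_mul, Complex.ofReal_mul]
    generalize (Real.exp (π * t * (u / t) ^ 2) : ℂ) = e at *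
    generalize Complex.exp (-(π * u ^ 2 / t)) = e1 at *
    field_simp
    linear_combination -(HurwitzZeta.cosKernel (u : UnitAddCircle) t : ℂ) * this
  have hB : (HurwitzZeta.cosKernel ((u + 1 / 2 : ℝ) : UnitAddCircle) t : ℂ) =
      2 * (Real.cosh (π * (u / t)) : ℂ) * (BB t (u / t) : ℂ) * Complex.exp (-(π * u ^ 2 / t)) *
        Complex.exp (-(π / (4 * t))) / (Real.sqrt t : ℝ) := by
    rw [BB, hux]
    have : (Real.exp (π * t * (u / t) ^ 2 + π / (4 * t)) : ℂ) * (Complex.exp (-(π * u ^ 2 / t)) *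
      Complex.exp (-(π / (4 * t)))) = 1 := by
      push_cast
      rw [← Complex.exp_add, ← Complex.exp_add, ← Complex.exp_zero]; congr 1; field_simp; ring
    have hc : (Real.cosh (π * (u / t)) : ℂ) ≠ 0 := by
      exact_mod_cast (Real.cosh_pos _).ne'
    rw [Complex.ofReal_div, Complex.ofReal_mul, Complex.ofReal_mul, Complex.ofReal_mul]
    generalize (Real.cosh (π * (u / t)) : ℂ) = c at *
    generalize (Real.exp (π * t * (u / t) ^ 2 + π / (4 * t)) : ℂ) = e at *
    generalize Complex.exp (-(π * u ^ 2 / t)) = e1 at *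
    generalize Complex.exp (-(π / (4 * t))) = e2 at *
    generalize (HurwitzZeta.cosKernel ((u + 1 / 2 : ℝ) : UnitAddCircle) t : ℂ) = k at *
    push_cast
    field_simp
    linear_combination -k * this
  rw [theta3 u t ht, theta4 u t ht, eta_S t ht, hA, hB,
    show (1 + (n : ℤ) - (n + 1 + p : ℕ)) = -(p : ℤ) by push_cast; ring]
  simp only [zpow_neg, zpow_natCast]
  have e1 : Complex.exp (π * Complex.I * (((n + 1 + p : ℕ) : ℂ) - n) * u) =
      ((Complex.exp (-(π * Complex.I * u)))⁻¹) ^ (p + 1) := by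
    rw [← Complex.exp_neg, ← Complex.exp_nat_mul]; congr 1; push_cast; ring
  rw [e1, alg1 (L := Complex.exp (-(π * t * p / 12))) (hX := Complex.exp_ne_zero _)
    (hY := Complex.exp_ne_zero _) (hR := hR) (hG := Complex.exp_ne_zero _)
    ]
  · rw [gg]
    have e2 : Complex.exp (-(π * t * p / 12)) *
        ((Complex.exp (-(π / (12 * t))) ^ p)⁻¹ * (Complex.exp (-(π / (4 * t))) ^ n)⁻¹) =
        ((Real.exp (π * t * ((n : ℝ) - (n + 1 + p : ℕ) + 1) / 12 +
        π * (((n + 1 + p : ℕ) : ℝ) + 2 * n - 1) / (12 * t)) : ℝ) : ℂ) := by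
      rw [← Complex.exp_nat_mul, ← Complex.exp_nat_mul, ← Complex.exp_neg, ← Complex.exp_neg,
        ← Complex.exp_add, ← Complex.exp_add]
      push_cast
      congr 1
      field_simp
      ring
    have e3 : Complex.exp (zz (p + 1) ℓ t (u / t)) =
        Complex.exp (-(π * u ^ 2 / t)) ^ (p + 1) * Complex.exp (-2 * π * Complex.I * ℓ * u) := by
      rw [← Complex.exp_nat_mul, ← Complex.exp_add, zz]
      congr 1
      push_cast
      field_simp
      ring
    rw [e2, e3]
    ring
  · rw [← Complex.exp_nat_mul, ← Complex.exp_add]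
    congr 1
    push_cast
    ring

lemma KWchar_eq (ℓ : ℤ) (p n : ℕ) (t : ℝ) (ht : 0 < t) :
    KWchar (n + 1 + p) n ℓ t =
    ((Real.exp (π * t * ((n : ℝ) - (n + 1 + p : ℕ) + 1) / 12 +
        π * (((n + 1 + p : ℕ) : ℝ) + 2 * n - 1) / (12 * t)) * (Real.sqrt t / 2 ^ n) : ℝ) : ℂ) *
      ∫ x in (-(1 / (2 * t)))..(1 / (2 * t)), gg p n ℓ t x := by
  rw [KWchar]
  simp_rw [integrand_eq ℓ p n t _ ht]
  rw [intervalIntegral.integral_const_mul, intervalIntegral.integral_comp_div _ ht.ne']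
  have e1 : -(1 / 2) / t = -(1 / (2 * t)) := by field_simp
  have e2 : (1 / 2) / t = (1 / (2 * t)) := by field_simp
  rw [e1, e2, Complex.real_smul]
  have : ((Real.sqrt t : ℝ) : ℂ) * ((Real.sqrt t : ℝ) : ℂ) = t := by
    rw [← Complex.ofReal_mul, Real.mul_self_sqrt ht.le]
  have hR : ((Real.sqrt t : ℝ) : ℂ) ≠ 0 := by
    exact_mod_cast (Real.sqrt_pos.mpr ht).ne'
  rw [← this, Complex.ofReal_mul, Complex.ofReal_div]
  push_cast
  field_simp
end KW
namespace KW
open MeasureTheory Filter Topology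

lemma near_mul {ε C D : ℝ} (hε0 : 0 ≤ ε) (hε : ε ≤ 1) (hC : 0 ≤ C) (hD : 0 ≤ D) {a b : ℂ}
    (ha : ‖a - 1‖ ≤ C * ε) (hb : ‖b - 1‖ ≤ D * ε) : ‖a * b - 1‖ ≤ (C + D + C * D) * ε := by
  have e : a * b - 1 = (a - 1) * (b - 1) + (a - 1) + (b - 1) := by ring
  rw [e]
  have h1 : ‖(a - 1) * (b - 1)‖ ≤ C * D * ε := by
    rw [norm_mul]
    calc _ ≤ (C * ε) * (D * ε) := by gcongr
      _ = (C * D * ε) * ε := by ring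
      _ ≤ (C * D * ε) * 1 := by gcongr
      _ = _ := by ring
  calc _ ≤ ‖(a - 1) * (b - 1)‖ + ‖a - 1‖ + ‖b - 1‖ := norm_add₃_le
    _ ≤ _ := by linarith

lemma near_pow (C : ℝ) (hC : 0 ≤ C) (k : ℕ) : ∃ D : ℝ, 0 ≤ D ∧ ∀ (ε : ℝ) (a : ℂ), 0 ≤ ε → ε ≤ 1 →
    ‖a - 1‖ ≤ C * ε → ‖a ^ k - 1‖ ≤ D * ε := by
  induction k with
  | zero => exact ⟨0, le_rfl, fun ε a _ _ _ => by simp⟩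
  | succ k ih =>
    obtain ⟨D, hD, h⟩ := ih
    refine ⟨D + C + D * C, by positivity, fun ε a h0 h1 ha => ?_⟩
    rw [pow_succ]
    exact near_mul h0 h1 hD hC (h ε a h0 h1 ha) ha

lemma PP_near (p : ℕ) : ∃ C : ℝ, 0 ≤ C ∧ ∀ᶠ t : ℝ in 𝓝[>] 0,
    ‖((PP (Complex.exp (-(2 * π / t)))) ^ p)⁻¹ - 1‖ ≤ C * Real.exp (-π / t) := by
  have hP0 : PP 0 = 1 := by simp [PP]
  have hd : DifferentiableAt ℂ PP 0 := by
    have := ModularForm.differentiableOn_tprod_one_sub_pow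
    exact this.differentiableAt (Metric.ball_mem_nhds _ one_pos)
  have hd2 : DifferentiableAt ℂ (fun q => ((PP q) ^ p)⁻¹) 0 :=
    (hd.pow p).inv (by simp [hP0])
  have hO := hd2.isBigO_sub
  simp only [hP0, one_pow, inv_one, sub_zero] at hO
  obtain ⟨C, hC, hb⟩ := hO.exists_nonneg
  refine ⟨C, hC, ?_⟩
  have htend : Tendsto (fun t : ℝ => Complex.exp (-(2 * π / t))) (𝓝[>] 0) (𝓝 0) := by
    rw [tendsto_zero_iff_norm_tendsto_zero]
    have h1 : Tendsto (fun t : ℝ => Real.exp (-(2 * π * t⁻¹))) (𝓝[>] 0) (𝓝 0) := by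
      apply Real.tendsto_exp_neg_atTop_nhds_zero.comp
      exact Tendsto.const_mul_atTop (by positivity) tendsto_inv_nhdsGT_zero
    refine h1.congr fun t => ?_
    rw [show (-(2 * π / t) : ℂ) = ((-(2 * π * t⁻¹) : ℝ) : ℂ) by push_cast; ring,
      ← Complex.ofReal_exp, Complex.norm_real, Real.norm_eq_abs, Real.abs_exp]
  filter_upwards [htend.eventually hb.bound, self_mem_nhdsWithin] with t h1 ht
  have ht : 0 < t := ht
  refine h1.trans (mul_le_mul_of_nonneg_left ?_ hC)
  rw [show (-(2 * π / t) : ℂ) = ((-(2 * π / t) : ℝ) : ℂ) by push_cast; ring,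
      ← Complex.ofReal_exp, Complex.norm_real, Real.norm_eq_abs, Real.abs_exp, Real.exp_le_exp]
  have : 0 < π / t := by positivity
  have e : -(2 * π / t) = -2 * (π / t) := by ring
  have e' : -π / t = -(π / t) := by ring
  linarith

lemma W_near (p n : ℕ) : ∃ C : ℝ, 0 ≤ C ∧ ∀ᶠ t : ℝ in 𝓝[>] 0, ∀ x : ℝ, |x| ≤ 1 / (2 * t) →
    ‖((PP (Complex.exp (-(2 * π / t)))) ^ p)⁻¹ *
      ((AA t x : ℂ) ^ (n + 1 + p) * ((BB t x : ℂ)⁻¹) ^ n) - 1‖ ≤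
      C * Real.exp (-π / t + 2 * π * |x|) := by
  obtain ⟨C, hC, hP⟩ := PP_near p
  have hC0 : 0 ≤ C0 := tsum_nonneg fun k => (Real.exp_pos _).le
  have hC1 : 0 ≤ C1 := tsum_nonneg fun k => by positivity
  obtain ⟨D, hD, hA⟩ := near_pow C0 hC0 (n + 1 + p)
  obtain ⟨E, hE, hB⟩ := near_pow C1 hC1 n
  refine ⟨C + (D + E + D * E) + C * (D + E + D * E), by positivity, ?_⟩
  filter_upwards [hP, Ioo_mem_nhdsGT (zero_lt_one' ℝ)] with t h1 ht x hx
  have ht0 : 0 < t := ht.1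
  have hε : Real.exp (-π / t + 2 * π * |x|) ≤ 1 := by
    rw [Real.exp_le_one_iff]
    have : 2 * π * |x| ≤ 2 * π * (1 / (2 * t)) := by gcongr
    have e : 2 * π * (1 / (2 * t)) = π / t := by field_simp
    have e' : -π / t = -(π / t) := by ring
    linarith
  have h0 := (Real.exp_pos (-π / t + 2 * π * |x|)).le
  refine near_mul h0 hε hC (by positivity) ?_ (near_mul h0 hε hD hE ?_ ?_)
  · refine h1.trans (mul_le_mul_of_nonneg_left (Real.exp_le_exp.mpr ?_) hC)
    have : 0 ≤ 2 * π * |x| := by positivity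
    linarith
  · refine hA _ _ h0 hε ?_
    rw [← Complex.ofReal_one, ← Complex.ofReal_sub, Complex.norm_real]
    exact AA_bound t x ht0 ht.2.le hx
  · refine hB _ _ h0 hε ?_
    have hb := BB_ge t x ht0
    have hb2 := BB_bound t x ht0 ht.2.le hx
    rw [← Complex.ofReal_one, ← Complex.ofReal_inv, ← Complex.ofReal_sub, Complex.norm_real,
      Real.norm_eq_abs]
    refine le_trans ?_ hb2
    have : (BB t x)⁻¹ - 1 = -((BB t x - 1) * (BB t x)⁻¹) := by
      field_simp; ring
    rw [this, abs_neg, abs_mul]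
    refine mul_le_of_le_one_right (abs_nonneg _) ?_
    rw [abs_of_pos (by positivity)]
    exact inv_le_one_of_one_le₀ hb

lemma exp_taylor (K : ℕ) (hK : 1 ≤ K) (z : ℂ) (hz : z.re ≤ 0) :
    ‖Complex.exp z - ∑ r ∈ Finset.range K, z ^ r / r.factorial‖ ≤ (K + 3) * ‖z‖ ^ K := by
  rcases le_total ‖z‖ 1 with h | h
  · refine (Complex.norm_exp_sub_sum_le_norm_mul_exp z K).trans ?_
    have : Real.exp ‖z‖ ≤ K + 3 := by
      have h1 : Real.exp ‖z‖ ≤ Real.exp 1 := Real.exp_le_exp.mpr h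
      have := Real.exp_one_lt_d9
      have : (0 : ℝ) ≤ K := by positivity
      linarith
    rw [mul_comm]
    gcongr
  · have h1 : ‖Complex.exp z‖ ≤ 1 := by
      rw [Complex.norm_exp]; simpa using hz
    have h2 : ‖∑ r ∈ Finset.range K, z ^ r / r.factorial‖ ≤ K * ‖z‖ ^ K := by
      refine (norm_sum_le_of_le (f := fun r : ℕ => z ^ r / (r.factorial : ℂ))
        (n := fun _ => ‖z‖ ^ K) _ ?_).trans (by simp)
      intro r hr
      rw [norm_div, norm_pow, Complex.norm_natCast]
      refine (div_le_self (by positivity) (by exact_mod_cast Nat.one_le_iff_ne_zero.mpr (Nat.factorial_ne_zero r))).trans ?_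
      exact pow_le_pow_right₀ h (Finset.mem_range.mp hr).le
    have h3 : 1 ≤ ‖z‖ ^ K := one_le_pow₀ h
    calc _ ≤ _ := norm_sub_le _ _
      _ ≤ _ := by nlinarith

lemma sum_far (K : ℕ) (w : ℝ) (hw : 1 ≤ w) (z : ℂ) (hz : ‖z‖ ≤ w) :
    ‖∑ r ∈ Finset.range K, z ^ r / r.factorial‖ ≤ K * w ^ K := by
  refine (norm_sum_le_of_le (f := fun r : ℕ => z ^ r / (r.factorial : ℂ))
    (n := fun _ => w ^ K) _ ?_).trans (by simp)
  intro r hr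
  rw [norm_div, norm_pow, Complex.norm_natCast]
  refine (div_le_self (by positivity) (by exact_mod_cast Nat.one_le_iff_ne_zero.mpr (Nat.factorial_ne_zero r))).trans ?_
  exact (pow_le_pow_left₀ (norm_nonneg _) hz r).trans
    (pow_le_pow_right₀ hw (Finset.mem_range.mp hr).le)

lemma zz_re (d : ℝ) (hd : 0 ≤ d) (ℓ : ℤ) (t x : ℝ) (ht : 0 < t) : (zz d ℓ t x).re ≤ 0 := by
  have : zz d ℓ t x = ((-(π * t * (d * x ^ 2)) : ℝ) : ℂ) +
      ((-(π * t * (2 * ℓ * x)) : ℝ) : ℂ) * Complex.I := by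
    rw [zz]; push_cast; ring
  rw [this]
  simp only [Complex.add_re, Complex.ofReal_re, Complex.re_ofReal_mul, Complex.I_re, mul_zero, add_zero]
  have : 0 ≤ π * t * (d * x ^ 2) := by positivity
  linarith

lemma zz_norm (d : ℝ) (hd : 0 ≤ d) (ℓ : ℤ) (t x : ℝ) (ht : 0 < t) :
    ‖zz d ℓ t x‖ ≤ (π * (d + 2 * |(ℓ : ℝ)|) + 2) * (t * (|x| * (1 + |x|))) := by
  rw [zz, norm_mul, norm_mul, norm_neg, Complex.norm_real, Complex.norm_real, Real.norm_eq_abs,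
    Real.norm_eq_abs, abs_of_pos Real.pi_pos, abs_of_pos ht]
  have h1 : ‖(d : ℂ) * (x : ℂ) ^ 2 + 2 * Complex.I * ℓ * x‖ ≤ d * |x| ^ 2 + 2 * |(ℓ : ℝ)| * |x| := by
    refine (norm_add_le _ _).trans (le_of_eq ?_)
    simp [abs_of_nonneg hd]
  have h2 : d * |x| ^ 2 + 2 * |(ℓ : ℝ)| * |x| ≤ (d + 2 * |(ℓ : ℝ)|) * (|x| * (1 + |x|)) := by
    have := abs_nonneg x
    have := abs_nonneg (ℓ : ℝ)
    have a1 : 0 ≤ d * |x| := by positivity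
    have a2 : 0 ≤ |(ℓ : ℝ)| * |x| ^ 2 := by positivity
    nlinarith
  calc π * t * _ ≤ π * t * ((d + 2 * |(ℓ : ℝ)|) * (|x| * (1 + |x|))) := by
        gcongr; exact h1.trans h2
    _ = (π * (d + 2 * |(ℓ : ℝ)|)) * (t * (|x| * (1 + |x|))) := by ring
    _ ≤ _ := by gcongr; linarith

lemma poly_le (K : ℕ) (hK : 1 ≤ K) (y : ℝ) (hy : 0 ≤ y) :
    (y * (1 + y)) ^ K ≤ (4 * (K : ℝ) ^ 2) ^ K * Real.exp y := by
  have hK' : (1 : ℝ) ≤ K := by exact_mod_cast hK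
  have h := Real.add_one_le_exp (y / (2 * K))
  have h2 : (1 + y) ≤ 2 * K * Real.exp (y / (2 * K)) := by
    have : 2 * K * (y / (2 * K) + 1) ≤ 2 * K * Real.exp (y / (2 * K)) := by gcongr
    have e : 2 * K * (y / (2 * K) + 1) = y + 2 * K := by field_simp
    linarith
  have h3 : y * (1 + y) ≤ 4 * (K : ℝ) ^ 2 * Real.exp (y / K) := by
    calc y * (1 + y) ≤ (2 * K * Real.exp (y / (2 * K))) * (2 * K * Real.exp (y / (2 * K))) := by
          gcongr; linarith
      _ = 4 * (K : ℝ) ^ 2 * (Real.exp (y / (2 * K)) * Real.exp (y / (2 * K))) := by ring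
      _ = _ := by rw [← Real.exp_add]; congr 2; field_simp; ring
  calc _ ≤ (4 * (K : ℝ) ^ 2 * Real.exp (y / K)) ^ K := by gcongr
    _ = _ := by rw [mul_pow, ← Real.exp_nat_mul]; congr 2; field_simp

lemma sech_le (n : ℕ) (hn : 1 ≤ n) (x : ℝ) :
    (Real.cosh (π * x) ^ n)⁻¹ ≤ 2 * Real.exp (-(π * |x|)) := by
  have h1 : Real.cosh (π * x) ≤ Real.cosh (π * x) ^ n :=
    le_self_pow₀ (Real.one_le_cosh _) (by omega)
  have h2 : Real.exp (π * |x|) ≤ 2 * Real.cosh (π * x) := by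
    rw [← Real.cosh_abs, abs_mul, abs_of_pos Real.pi_pos, Real.cosh_eq]
    linarith [Real.exp_pos (-(π * |x|))]
  have h3 := Real.cosh_pos (π * x)
  calc _ ≤ (Real.exp (π * |x|) / 2)⁻¹ := by
        apply inv_anti₀ (by positivity); linarith
    _ = _ := by rw [Real.exp_neg, inv_div]; ring

lemma integrable_H : Integrable (fun x : ℝ => Real.exp (-|x|)) := by
  refine (integrable_inv_one_add_sq.const_mul 2).mono' (by fun_prop) (Eventually.of_forall fun x => ?_)
  rw [Real.norm_eq_abs, Real.abs_exp, Real.exp_neg]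
  have h := Real.quadratic_le_exp_of_nonneg (abs_nonneg x)
  rw [sq_abs] at h
  have h2 := abs_nonneg x
  calc (Real.exp |x|)⁻¹ ≤ ((1 + x ^ 2) / 2)⁻¹ := by
        apply inv_anti₀ (by positivity); nlinarith
    _ = _ := by rw [inv_div]; ring

lemma integrable_moment (j n : ℕ) (hn : 1 ≤ n) :
    Integrable (fun x : ℝ => x ^ j / Real.cosh (π * x) ^ n) := by
  refine (integrable_H.const_mul (j.factorial * 2 : ℝ)).mono' ?_ (Eventually.of_forall fun x => ?_)
  · refine (Continuous.div (by fun_prop) (by fun_prop) fun x => ?_).aestronglyMeasurable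
    have := Real.cosh_pos (π * x); positivity
  · have hc := Real.cosh_pos (π * x)
    rw [norm_div, norm_pow, norm_pow, Real.norm_eq_abs, Real.norm_eq_abs, abs_of_pos hc,
      div_eq_mul_inv]
    have h1 := Real.pow_div_factorial_le_exp |x| (abs_nonneg x) j
    rw [div_le_iff₀ (by positivity)] at h1
    calc _ ≤ (Real.exp |x| * j.factorial) * (2 * Real.exp (-(π * |x|))) := by
          gcongr; exact sech_le n hn x
      _ = (j.factorial * 2) * (Real.exp |x| * Real.exp (-(π * |x|))) := by ring
      _ ≤ _ := by
        rw [← Real.exp_add]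
        gcongr
        nlinarith [Real.pi_gt_three, abs_nonneg x]

/-- Taylor polynomial -/
noncomputable def SS (K p n : ℕ) (ℓ : ℤ) (t x : ℝ) : ℂ :=
  (∑ r ∈ Finset.range K, zz (p + 1) ℓ t x ^ r / r.factorial) / (Real.cosh (π * x) : ℂ) ^ n

lemma SS_eq (K p n : ℕ) (ℓ : ℤ) (t x : ℝ) : SS K p n ℓ t x =
    ∑ r ∈ Finset.range K, ∑ k ∈ Finset.range (r + 1),
      ((-(π : ℂ)) ^ r * ((r.choose k : ℂ) * (((n + 1 + p : ℕ) : ℂ) - n) ^ k *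
        (2 * Complex.I * ℓ) ^ (r - k)) * t ^ r / r.factorial) *
        ((x ^ (k + r) / Real.cosh (π * x) ^ n : ℝ) : ℂ) := by
  rw [SS, Finset.sum_div]
  refine Finset.sum_congr rfl fun r _ => ?_
  rw [zz, mul_pow, mul_pow, add_pow, Finset.mul_sum, Finset.sum_div, Finset.sum_div]
  refine Finset.sum_congr rfl fun k hk => ?_
  have hk : k ≤ r := by simpa [Nat.lt_succ_iff] using hk
  rw [mul_pow, mul_pow _ (x : ℂ), ← pow_mul, show k + r = 2 * k + (r - k) by omega]
  push_cast
  rw [pow_add]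
  ring

lemma SS_integrable (K p n : ℕ) (hn : 1 ≤ n) (ℓ : ℤ) (t : ℝ) : Integrable (SS K p n ℓ t) := by
  rw [funext (SS_eq K p n ℓ t)]
  refine integrable_finsetSum _ fun r _ => integrable_finsetSum _ fun k _ => ?_
  exact (integrable_moment _ n hn).ofReal.const_mul _

lemma SS_integral (K p n : ℕ) (hn : 1 ≤ n) (ℓ : ℤ) (t : ℝ) : ∫ x, SS K p n ℓ t x =
    ∑ r ∈ Finset.range K, KWcoeff (n + 1 + p) n ℓ r * t ^ r / r.factorial := by
  rw [funext (SS_eq K p n ℓ t)]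
  have hi : ∀ (c : ℂ) (j : ℕ), Integrable
      (fun x : ℝ => c * ((x ^ j / Real.cosh (π * x) ^ n : ℝ) : ℂ)) :=
    fun c j => (integrable_moment _ n hn).ofReal.const_mul _
  rw [integral_finsetSum _ fun r _ => integrable_finsetSum _ fun k _ => hi _ _]
  refine Finset.sum_congr rfl fun r _ => ?_
  rw [integral_finsetSum _ fun k _ => hi _ _, KWcoeff, Finset.mul_sum, Finset.sum_mul,
    Finset.sum_div]
  refine Finset.sum_congr rfl fun k _ => ?_
  rw [integral_const_mul, integral_complex_ofReal, coshMoment]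
  ring
end KW
namespace KW
open MeasureTheory Filter Topology

lemma exp_small (K : ℕ) (t : ℝ) (ht : 0 < t) : Real.exp (-(1 / t)) ≤ K.factorial * t ^ K := by
  have h := Real.pow_div_factorial_le_exp (1 / t) (by positivity) K
  rw [Real.exp_neg]
  calc _ ≤ ((1 / t) ^ K / K.factorial)⁻¹ := inv_anti₀ (by positivity) h
    _ = _ := by rw [inv_div, one_div, inv_pow]; field_simp

lemma gg_cont (p n : ℕ) (ℓ : ℤ) (t : ℝ) (ht : 0 < t) : Continuous (gg p n ℓ t) := by
  unfold gg zz
  have hA := cont_AA t ht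
  have hB : Continuous fun x => ((BB t x : ℂ))⁻¹ := by
    refine (Complex.continuous_ofReal.comp (cont_BB t ht)).inv₀ fun x => ?_
    have := BB_ge t x ht
    simp only [Function.comp]
    exact_mod_cast (by linarith : (0:ℝ) < BB t x).ne'
  refine Continuous.div (by fun_prop) (by fun_prop) fun x => ?_
  exact_mod_cast (pow_pos (Real.cosh_pos (π * x)) n).ne'

lemma taylor_part (K : ℕ) (hK : 1 ≤ K) (c : ℝ) (hc : 0 ≤ c) (n : ℕ) (hn : 1 ≤ n) (t x : ℝ) (ht : 0 < t) :
    (c * (t * (|x| * (1 + |x|)))) ^ K * (Real.cosh (π * x) ^ n)⁻¹ ≤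
      (2 * c ^ K * (4 * (K : ℝ) ^ 2) ^ K) * (t ^ K * Real.exp (-|x|)) := by
  have h1 := poly_le K hK |x| (abs_nonneg x)
  have h2 := sech_le n hn x
  have h3 : 0 ≤ (Real.cosh (π * x) ^ n)⁻¹ := by
    have := Real.cosh_pos (π * x); positivity
  rw [mul_pow, mul_pow]
  calc _ ≤ c ^ K * (t ^ K * ((4 * (K : ℝ) ^ 2) ^ K * Real.exp |x|)) * (2 * Real.exp (-(π * |x|))) := by
        gcongr
    _ = (2 * c ^ K * (4 * (K : ℝ) ^ 2) ^ K) * (t ^ K * (Real.exp |x| * Real.exp (-(π * |x|)))) := by ring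
    _ ≤ _ := by
      rw [← Real.exp_add]
      gcongr
      nlinarith [Real.pi_gt_three, abs_nonneg x]

lemma pointwise (K p n : ℕ) (hK : 1 ≤ K) (hn : 1 ≤ n) (ℓ : ℤ) : ∃ C : ℝ, 0 ≤ C ∧
    ∀ᶠ t : ℝ in 𝓝[>] 0, ∀ x : ℝ,
    (|x| ≤ 1 / (2 * t) → ‖gg p n ℓ t x - SS K p n ℓ t x‖ ≤ C * (t ^ K * Real.exp (-|x|))) ∧
    (1 / (2 * t) ≤ |x| → ‖SS K p n ℓ t x‖ ≤ C * (t ^ K * Real.exp (-|x|))) := by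
  obtain ⟨C, hC, hW⟩ := W_near p n
  set c : ℝ := π * (((p : ℝ) + 1) + 2 * |(ℓ : ℝ)|) + 2 with hc
  have hd : (0 : ℝ) ≤ (p : ℝ) + 1 := by positivity
  have hc2 : 2 ≤ c := by
    have : 0 ≤ π * (((p : ℝ) + 1) + 2 * |(ℓ : ℝ)|) := by positivity
    linarith
  have hc0 : 0 ≤ c := by linarith
  set T : ℝ := 2 * c ^ K * (4 * (K : ℝ) ^ 2) ^ K with hT
  have hT0 : 0 ≤ T := by positivity
  refine ⟨2 * C * K.factorial + (K + 3) * T, by positivity, ?_⟩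
  filter_upwards [hW, self_mem_nhdsWithin] with t hWt ht x
  have ht : 0 < t := ht
  have hch := Real.cosh_pos (π * x)
  have hz := zz_norm _ hd ℓ t x ht
  have hre := zz_re _ hd ℓ t x ht
  rw [← hc] at hz
  have htp := taylor_part K hK c hc0 n hn t x ht
  rw [← hT] at htp
  have hnc : ∀ w : ℂ, ‖w / (Real.cosh (π * x) : ℂ) ^ n‖ = ‖w‖ * (Real.cosh (π * x) ^ n)⁻¹ := by
    intro w
    rw [norm_div, norm_pow, Complex.norm_real, Real.norm_eq_abs, abs_of_pos hch, div_eq_mul_inv]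
  have hX : 0 ≤ t ^ K * Real.exp (-|x|) := by positivity
  constructor
  · intro hx
    have hw := hWt x hx
    set W := ((PP (Complex.exp (-(2 * π / t)))) ^ p)⁻¹ *
      ((AA t x : ℂ) ^ (n + 1 + p) * ((BB t x : ℂ)⁻¹) ^ n) with hWd
    have e : gg p n ℓ t x - SS K p n ℓ t x =
        ((W - 1) * Complex.exp (zz (p + 1) ℓ t x)) / (Real.cosh (π * x) : ℂ) ^ n +
        (Complex.exp (zz (p + 1) ℓ t x) - ∑ r ∈ Finset.range K, zz (p + 1) ℓ t x ^ r / r.factorial) /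
          (Real.cosh (π * x) : ℂ) ^ n := by
      rw [gg, SS, hWd]; ring
    rw [e]
    refine (norm_add_le _ _).trans ?_
    rw [hnc, hnc, norm_mul, add_mul]
    have he1 : ‖Complex.exp (zz (p + 1) ℓ t x)‖ ≤ 1 := by
      rw [Complex.norm_exp]; simpa using hre
    refine add_le_add ?_ ?_
    · calc _ ≤ (C * Real.exp (-π / t + 2 * π * |x|)) * 1 * (2 * Real.exp (-(π * |x|))) := by
            gcongr; exact sech_le n hn x
        _ = 2 * C * (Real.exp (-π / t + 2 * π * |x|) * Real.exp (-(π * |x|))) := by ring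
        _ ≤ 2 * C * (Real.exp (-(1 / t)) * Real.exp (-|x|)) := by
            rw [← Real.exp_add, ← Real.exp_add]
            refine mul_le_mul_of_nonneg_left (Real.exp_le_exp.mpr ?_) (by positivity)
            have e1 : 1 / (2 * t) = (1 / t) / 2 := by field_simp
            have e2 : -π / t = -π * (1 / t) := by ring
            rw [e1] at hx
            rw [e2]
            have hs : 0 < 1 / t := by positivity
            generalize 1 / t = s at *
            nlinarith [Real.pi_gt_three, abs_nonneg x,
              mul_le_mul_of_nonneg_left hx (by linarith [Real.pi_gt_three] : 0 ≤ π + 1)]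
        _ ≤ 2 * C * ((K.factorial * t ^ K) * Real.exp (-|x|)) := by
            gcongr; exact exp_small K t ht
        _ = _ := by ring
    · calc _ ≤ ((K + 3) * (c * (t * (|x| * (1 + |x|)))) ^ K) * (Real.cosh (π * x) ^ n)⁻¹ := by
            gcongr
            refine (exp_taylor K hK _ hre).trans ?_
            gcongr
        _ = (K + 3) * ((c * (t * (|x| * (1 + |x|)))) ^ K * (Real.cosh (π * x) ^ n)⁻¹) := by ring
        _ ≤ (K + 3) * (T * (t ^ K * Real.exp (-|x|))) := by gcongr
        _ = _ := by ring
  · intro hx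
    rw [SS, hnc]
    have hw1 : 1 ≤ c * (t * (|x| * (1 + |x|))) := by
      rw [div_le_iff₀ (by positivity)] at hx
      have h1 : 0 ≤ t * |x| := by positivity
      have h2 : t * |x| ≤ t * (|x| * (1 + |x|)) := by
        have := abs_nonneg x
        gcongr; nlinarith
      nlinarith
    calc _ ≤ (K * (c * (t * (|x| * (1 + |x|)))) ^ K) * (Real.cosh (π * x) ^ n)⁻¹ := by
          gcongr; exact sum_far K _ hw1 _ hz
      _ = K * ((c * (t * (|x| * (1 + |x|)))) ^ K * (Real.cosh (π * x) ^ n)⁻¹) := by ring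
      _ ≤ K * (T * (t ^ K * Real.exp (-|x|))) := by gcongr
      _ = (K * T) * (t ^ K * Real.exp (-|x|)) := by ring
      _ ≤ _ := by
        apply mul_le_mul_of_nonneg_right _ hX
        have : 0 ≤ 2 * C * K.factorial := by positivity
        linarith

lemma int_bound (K p n : ℕ) (hK : 1 ≤ K) (hn : 1 ≤ n) (ℓ : ℤ) : ∃ C : ℝ,
    ∀ᶠ t : ℝ in 𝓝[>] 0,
    ‖(∫ x in (-(1 / (2 * t)))..(1 / (2 * t)), gg p n ℓ t x) - ∫ x, SS K p n ℓ t x‖ ≤ C * t ^ K := by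
  obtain ⟨C, hC, hp⟩ := pointwise K p n hK hn ℓ
  refine ⟨C * ∫ x : ℝ, Real.exp (-|x|), ?_⟩
  filter_upwards [hp, self_mem_nhdsWithin] with t hpt ht
  have ht : 0 < t := ht
  have ha : 0 ≤ 1 / (2 * t) := by positivity
  rw [intervalIntegral.integral_of_le (by linarith), ← integral_indicator measurableSet_Ioc,
    ← integral_sub _ (SS_integrable K p n hn ℓ t)]
  · have : (C * ∫ x : ℝ, Real.exp (-|x|)) * t ^ K = ∫ x : ℝ, C * (t ^ K * Real.exp (-|x|)) := by
      rw [integral_const_mul, integral_const_mul]; ring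
    rw [this]
    refine norm_integral_le_of_norm_le ((integrable_H.const_mul _).const_mul _)
      (Eventually.of_forall fun x => ?_)
    by_cases hx : x ∈ Set.Ioc (-(1 / (2 * t))) (1 / (2 * t))
    · rw [Set.indicator_of_mem hx]
      exact (hpt x).1 (abs_le.mpr ⟨hx.1.le, hx.2⟩)
    · rw [Set.indicator_of_notMem hx, zero_sub, norm_neg]
      refine (hpt x).2 ?_
      by_contra hlt
      push Not at hlt
      exact hx ⟨(abs_lt.mp hlt).1, (abs_lt.mp hlt).2.le⟩
  · rw [integrable_indicator_iff measurableSet_Ioc]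
    exact (gg_cont p n ℓ t ht).integrableOn_Ioc
end KW

/-- Fix integers `ℓ` and `m > n ≥ 1`. For every `N ∈ ℕ₀`, as `t → 0⁺`,
`Φ_ℓ(t) = e^{πt(n−m+1)/12 + π(m+2n−1)/(12t)} · (√t/2^n) ·
  (∑_{r=0}^N a_r(m,n,ℓ) t^r/r! + O(t^{N+1}))`. -/
theorem stmt_6 (ℓ : ℤ) (m n : ℕ) (h1 : 1 ≤ n) (h2 : n < m) (N : ℕ) :
    (fun t : ℝ => KWchar m n ℓ t -
        (Real.exp (π * t * ((n : ℝ) - m + 1) / 12 + π * ((m : ℝ) + 2 * n - 1) / (12 * t)) *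
            (Real.sqrt t / 2 ^ n) : ℝ) *
          ∑ r ∈ Finset.range (N + 1), KWcoeff m n ℓ r * t ^ r / r.factorial)
      =O[nhdsWithin 0 (Set.Ioi 0)]
        (fun t : ℝ =>
          Real.exp (π * t * ((n : ℝ) - m + 1) / 12 + π * ((m : ℝ) + 2 * n - 1) / (12 * t)) *
            (Real.sqrt t / 2 ^ n) * t ^ (N + 1)) := by

  obtain ⟨p, rfl⟩ : ∃ p, m = n + 1 + p := ⟨m - n - 1, by omega⟩
  obtain ⟨C, hC⟩ := KW.int_bound (N + 1) p n (by omega) h1 ℓ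
  refine Asymptotics.IsBigO.of_bound C ?_
  filter_upwards [hC, self_mem_nhdsWithin] with t hb ht
  have ht : 0 < t := ht
  rw [KW.KWchar_eq ℓ p n t ht, ← KW.SS_integral (N + 1) p n h1 ℓ t, ← mul_sub, norm_mul,
    norm_mul, Complex.norm_real, mul_left_comm]
  refine mul_le_mul_of_nonneg_left ?_ (norm_nonneg _)
  rwa [Real.norm_of_nonneg (by positivity)]
end

section
/- Let m > n > 0 be even integers. For every γ = (a b; c d) ∈ Γ₀(2) (i.e. a,b,c,d ∈ ℤ, ad − bc = 1, c ≡ 0 mod 2) there exists a 24th root of unity χ*(γ), depending only on γ, m, n, such that for all τ ∈ ℍ and all z ∈ ℂ with z ∉ ℤτ + ℤ: φ( z/(cτ+d); (aτ+b)/(cτ+d) ) = χ*(γ) · (cτ+d)^{(m−n)/2} · e^{πic(m−n)z²/(cτ+d)} · φ(z; τ). -/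
open Real

/-- The meromorphic Jacobi form `φ(z;τ) := ϑ(z+1/2;τ)^m / ϑ(z;τ)^n`. -/
noncomputable def phiKW (m n : ℕ) (z τ : ℂ) : ℂ :=
  jacobiThetaKW (z + 1 / 2) τ ^ m / jacobiThetaKW z τ ^ n

lemma kw_eq_theta2 (z τ : ℂ) : jacobiThetaKW z τ =
    Complex.exp (π * Complex.I * τ / 4 + π * Complex.I * (z + 1 / 2)) *
      jacobiTheta₂ (z + 1 / 2 + τ / 2) τ := by
  unfold jacobiThetaKW jacobiTheta₂
  rw [← tsum_mul_left]
  refine tsum_congr fun n => ?_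
  rw [jacobiTheta₂_term, ← Complex.exp_add]
  congr 1
  ring

lemma kw_T (z τ : ℂ) : jacobiThetaKW z (τ + 1) =
    Complex.exp (π * Complex.I / 4) * jacobiThetaKW z τ := by
  unfold jacobiThetaKW
  rw [← tsum_mul_left]
  refine tsum_congr fun n => ?_
  obtain ⟨k, hk⟩ := Int.even_mul_succ_self n
  have hk' : (n : ℂ) * (n + 1) = k + k := by exact_mod_cast hk
  rw [← Complex.exp_add, Complex.exp_eq_exp_iff_exists_int]
  refine ⟨k, ?_⟩
  linear_combination (π * Complex.I) * hk'

lemma kw_shift (w τ : ℂ) (l μ : ℤ) : jacobiThetaKW (w + l * τ + μ) τ =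
    Complex.exp (-π * Complex.I * l ^ 2 * τ - 2 * π * Complex.I * l * (w + 1 / 2)
      + π * Complex.I * μ) * jacobiThetaKW w τ := by
  unfold jacobiThetaKW
  rw [← (Equiv.addRight l).tsum_eq (fun n : ℤ => Complex.exp (π * Complex.I * ((n : ℂ) + 1 / 2) ^ 2 * τ +
      2 * π * Complex.I * ((n : ℂ) + 1 / 2) * (w + 1 / 2))), ← tsum_mul_left]
  refine tsum_congr fun n => ?_
  rw [← Complex.exp_add, Complex.exp_eq_exp_iff_exists_int]
  refine ⟨n * μ, ?_⟩
  simp only [Equiv.coe_addRight]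
  push_cast
  ring

lemma kw_S (z τ : ℂ) (hτ : 0 < τ.im) : jacobiThetaKW (z / τ) (-1 / τ) ^ 2 =
    Complex.I * τ * Complex.exp (2 * π * Complex.I * z ^ 2 / τ) * jacobiThetaKW z τ ^ 2 := by
  have h0 : τ ≠ 0 := by rintro rfl; simp at hτ
  have hI := Complex.I_ne_zero
  have h1 := jacobiTheta₂_functional_equation (z + τ / 2 - 1 / 2) τ
  have h2 := jacobiTheta₂_add_left (z + τ / 2 - 1 / 2) τ
  have h3 : ((-Complex.I * τ) ^ (1 / 2 : ℂ)) ^ 2 = -Complex.I * τ := by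
    rw [← Complex.cpow_nat_mul]; norm_num
  rw [kw_eq_theta2, kw_eq_theta2]
  have e1 : z / τ + 1 / 2 + -1 / τ / 2 = (z + τ / 2 - 1 / 2) / τ := by field_simp; ring
  have e2 : z + 1 / 2 + τ / 2 = z + τ / 2 - 1 / 2 + 1 := by ring
  rw [e1, e2, h2, h1]
  simp only [mul_pow, div_pow, h3, one_pow, ← Complex.exp_nat_mul]
  set B := jacobiTheta₂ ((z + τ / 2 - 1 / 2) / τ) (-1 / τ) ^ 2
  have e3 : Complex.I * τ * Complex.exp (2 * π * Complex.I * z ^ 2 / τ) *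
     (Complex.exp (((2:ℕ):ℂ) * (π * Complex.I * τ / 4 + π * Complex.I * (z + 1 / 2))) *
      (1 / (-Complex.I * τ) * Complex.exp (((2:ℕ):ℂ) * (-π * Complex.I * (z + τ / 2 - 1 / 2) ^ 2 / τ)) * B))
     = - (Complex.exp (2 * π * Complex.I * z ^ 2 / τ + ((2:ℕ):ℂ) * (π * Complex.I * τ / 4 + π * Complex.I * (z + 1 / 2)) + ((2:ℕ):ℂ) * (-π * Complex.I * (z + τ / 2 - 1 / 2) ^ 2 / τ))) * B := by
    rw [Complex.exp_add, Complex.exp_add]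
    field_simp
  rw [e3]
  have e4 : ∀ x : ℂ, -Complex.exp x = Complex.exp (π * Complex.I + x) := fun x => by
    rw [Complex.exp_add, Complex.exp_pi_mul_I]; ring
  rw [e4]
  congr 1
  rw [Complex.exp_eq_exp_iff_exists_int]
  refine ⟨-1, ?_⟩
  push_cast
  field_simp
  ring

def KWP (a b c d : ℤ) : Prop := ∃ ε : ℂ, ε ^ 4 = 1 ∧ ∀ τ : ℂ, 0 < τ.im → ∀ z : ℂ,
  jacobiThetaKW (z / ((c : ℂ) * τ + d)) (((a : ℂ) * τ + b) / ((c : ℂ) * τ + d)) ^ 2 =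
    ε * ((c : ℂ) * τ + d) * Complex.exp (2 * π * Complex.I * c * z ^ 2 / ((c : ℂ) * τ + d)) *
      jacobiThetaKW z τ ^ 2

lemma kw_denom_ne {a b c d : ℤ} (hdet : a * d - b * c = 1) {τ : ℂ} (hτ : 0 < τ.im) :
    (c : ℂ) * τ + d ≠ 0 := by
  intro h
  have h1 := congrArg Complex.im h
  have h2 := congrArg Complex.re h
  simp [hτ.ne'] at h1
  subst h1
  simp at h2
  subst h2
  simp at hdet

lemma kw_im_pos {a b c d : ℤ} (hdet : a * d - b * c = 1) {τ : ℂ} (hτ : 0 < τ.im) :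
    0 < (((a : ℂ) * τ + b) / ((c : ℂ) * τ + d)).im := by
  have h := Complex.normSq_pos.2 (kw_denom_ne hdet hτ)
  have hd : (a : ℝ) * d - b * c = 1 := by exact_mod_cast hdet
  have : (((a : ℂ) * τ + b) / ((c : ℂ) * τ + d)).im = τ.im / Complex.normSq ((c : ℂ) * τ + d) := by
    rw [Complex.div_im, ← sub_div]
    congr 1
    simp
    linear_combination τ.im * hd
  rw [this]; positivity

lemma KWP_mul {a b c d a' b' c' d' : ℤ} (h : a * d - b * c = 1) (h' : a' * d' - b' * c' = 1)
    (H : KWP a b c d) (H' : KWP a' b' c' d') :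
    KWP (a * a' + b * c') (a * b' + b * d') (c * a' + d * c') (c * b' + d * d') := by
  obtain ⟨ε, hε, H⟩ := H
  obtain ⟨ε', hε', H'⟩ := H'
  refine ⟨ε * ε', by rw [mul_pow, hε, hε', one_mul], fun τ hτ z => ?_⟩
  have hj' := kw_denom_ne h' hτ
  have hτ' := kw_im_pos h' hτ
  have hj := kw_denom_ne h hτ'
  have A := H _ hτ' (z / ((c' : ℂ) * τ + d'))
  rw [H' τ hτ z] at A
  have hd' : (a' : ℂ) * d' - b' * c' = 1 := by exact_mod_cast h'
  push_cast
  set j' := (c' : ℂ) * τ + d' with hj'def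
  set j := (c : ℂ) * ((a' * τ + b') / j') + d with hjdef
  have hq : ((a' : ℂ) * τ + b') / j' * j' = a' * τ + b' := div_mul_cancel₀ _ hj'
  have e1 : ((c : ℂ) * a' + d * c') * τ + (c * b' + d * d') = j * j' := by
    rw [hjdef]; linear_combination (-c : ℂ) * hq - d * hj'def
  have e2 : (((a : ℂ) * a' + b * c') * τ + (a * b' + b * d')) =
      (a * ((a' * τ + b') / j') + b) * j' := by
    linear_combination (-a : ℂ) * hq - b * hj'def
  rw [e1, e2, mul_div_mul_right _ _ hj', mul_comm j j', ← div_div, A]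
  have e3 : 2 * π * Complex.I * ((c : ℂ) * a' + d * c') * z ^ 2 / (j' * j) =
      2 * π * Complex.I * c * (z / j') ^ 2 / j + 2 * π * Complex.I * c' * z ^ 2 / j' := by
    have e4 : ((c : ℂ) * a' + d * c') * j' = c + c' * (j * j') := by
      rw [← e1, hj'def]; linear_combination (c : ℂ) * hd'
    field_simp
    linear_combination z ^ 2 * e4
  rw [e3, Complex.exp_add]
  ring

lemma KWP_inv {a b c d : ℤ} (h : a * d - b * c = 1) (H : KWP a b c d) :
    KWP d (-b) (-c) a := by
  obtain ⟨ε, hε, H⟩ := H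
  have hε0 : ε ≠ 0 := by rintro rfl; simp at hε
  refine ⟨ε⁻¹, by rw [inv_pow, hε, inv_one], fun τ hτ z => ?_⟩
  have h' : d * a - (-b) * (-c) = 1 := by linarith
  have hj := kw_denom_ne h' hτ
  have hτ' := kw_im_pos h' hτ
  have hjj := kw_denom_ne h hτ'
  have A := H _ hτ' (z / (((-c : ℤ) : ℂ) * τ + a))
  have hd : (a : ℂ) * d - b * c = 1 := by exact_mod_cast h
  set j := ((-c : ℤ) : ℂ) * τ + a with hjdef
  have e1 : (c : ℂ) * (((d : ℂ) * τ + (-b : ℤ)) / j) + d = 1 / j := by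
    field_simp; rw [hjdef]; push_cast; linear_combination hd
  have e2 : (a : ℂ) * (((d : ℂ) * τ + (-b : ℤ)) / j) + b = τ / j := by
    field_simp; rw [hjdef]; push_cast; linear_combination τ * hd
  rw [e1, e2] at A
  have e3 : z / j / (1 / j) = z := by field_simp
  have e4 : τ / j / (1 / j) = τ := by field_simp
  rw [e3, e4] at A
  rw [A]
  have e5 : 2 * π * Complex.I * ((-c : ℤ) : ℂ) * z ^ 2 / j =
      - (2 * π * Complex.I * c * (z / j) ^ 2 / (1 / j)) := by
    push_cast; field_simp
  rw [e5, Complex.exp_neg]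
  have := Complex.exp_ne_zero (2 * π * Complex.I * c * (z / j) ^ 2 / (1 / j))
  generalize Complex.exp (2 * π * Complex.I * c * (z / j) ^ 2 / (1 / j)) = E at *
  field_simp

lemma KWP_all (g : Matrix.SpecialLinearGroup (Fin 2) ℤ) :
    KWP (g 0 0) (g 0 1) (g 1 0) (g 1 1) := by
  have det : ∀ g : Matrix.SpecialLinearGroup (Fin 2) ℤ,
      g 0 0 * g 1 1 - g 0 1 * g 1 0 = 1 := fun g => by
    have := g.det_coe; rwa [Matrix.det_fin_two] at this
  have hg : g ∈ Subgroup.closure {ModularGroup.S, ModularGroup.T} := by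
    rw [SpecialLinearGroup.SL2Z_generators]; trivial
  induction hg using Subgroup.closure_induction with
  | mem x hx =>
    rcases hx with rfl | rfl
    · refine ⟨Complex.I, Complex.I_pow_four, fun τ hτ z => ?_⟩
      have := kw_S z τ hτ
      simpa [ModularGroup.S] using this
    · refine ⟨Complex.I, Complex.I_pow_four, fun τ hτ z => ?_⟩
      have := kw_T z τ
      have e : Complex.exp (π * Complex.I / 4) ^ 2 = Complex.I := by
        rw [← Complex.exp_nat_mul, show ((2 : ℕ) : ℂ) * (π * Complex.I / 4) = π / 2 * Complex.I by
          push_cast; ring]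
        exact Complex.exp_pi_div_two_mul_I
      simp [ModularGroup.T, this, mul_pow, e]
  | one => exact ⟨1, by simp, fun τ hτ z => by simp⟩
  | mul x y _ _ hx hy =>
    have := KWP_mul (det x) (det y) hx hy
    simpa [Matrix.mul_apply, Fin.sum_univ_two] using this
  | inv x _ hx =>
    have := KWP_inv (det x) hx
    simpa [Matrix.SpecialLinearGroup.coe_inv, Matrix.adjugate_fin_two] using this

/-- Let `m > n > 0` be even integers. For every `γ = (a b; c d) ∈ Γ₀(2)` there exists a
24th root of unity `χ*(γ)` (depending only on `γ, m, n`) such that for all `τ ∈ ℍ` and all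
`z ∈ ℂ` with `z ∉ ℤτ + ℤ`:
`φ(z/(cτ+d); (aτ+b)/(cτ+d)) = χ*(γ) · (cτ+d)^{(m−n)/2} · e^{πic(m−n)z²/(cτ+d)} · φ(z;τ)`. -/
theorem stmt_8 (m n : ℕ) (hn : 0 < n) (hnm : n < m) (hme : Even m) (hne : Even n)
    (a b c d : ℤ) (hdet : a * d - b * c = 1) (hc : 2 ∣ c) :
    ∃ χ : ℂ, χ ^ 24 = 1 ∧
      ∀ τ : ℂ, 0 < τ.im → ∀ z : ℂ, (∀ p q : ℤ, z ≠ p * τ + q) →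
        phiKW m n (z / ((c : ℂ) * τ + d)) (((a : ℂ) * τ + b) / ((c : ℂ) * τ + d))
          = χ * ((c : ℂ) * τ + d) ^ ((m - n) / 2) *
              Complex.exp (π * Complex.I * c * ((m : ℂ) - n) * z ^ 2 / ((c : ℂ) * τ + d)) *
              phiKW m n z τ := by
  have H : KWP a b c d := by
    have := KWP_all ⟨!![a, b; c, d], by rw [Matrix.det_fin_two_of]; exact hdet⟩
    simpa using this
  obtain ⟨ε, hε, H⟩ := H
  obtain ⟨k, rfl⟩ := hne
  obtain ⟨r, rfl⟩ := hme
  obtain ⟨l, rfl⟩ := hc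
  have hε0 : ε ≠ 0 := by rintro rfl; simp at hε
  have hd2 : ∃ μ : ℤ, d = 2 * μ + 1 := by
    have : ¬ Even d := by
      rintro ⟨e, rfl⟩
      have : 2 * (a * e - b * l) = 1 := by linear_combination hdet
      omega
    exact Int.not_even_iff_odd.1 this
  obtain ⟨μ, hμ⟩ := hd2
  set s : ℂ := Complex.exp (π * Complex.I * l * d) with hs
  have hs2 : s ^ 2 = 1 := by
    rw [hs, ← Complex.exp_nat_mul, Complex.exp_eq_one_iff]
    exact ⟨l * d, by push_cast; ring⟩
  refine ⟨(s * ε) ^ r / ε ^ k, ?_, fun τ hτ z _ => ?_⟩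
  · have h1 : ε ^ 24 = 1 := by rw [show 24 = 4 * 6 from rfl, pow_mul, hε, one_pow]
    have h2 : s ^ 24 = 1 := by rw [show 24 = 2 * 12 from rfl, pow_mul, hs2, one_pow]
    rw [div_pow, ← pow_mul, ← pow_mul, mul_comm r, mul_comm k, pow_mul, pow_mul, mul_pow, h1, h2]
    simp
  have hj := kw_denom_ne hdet hτ
  have A := H τ hτ z
  have B := H τ hτ (z + (((2 * l : ℤ) : ℂ) * τ + d) / 2)
  have e0 : (z + (((2 * l : ℤ) : ℂ) * τ + d) / 2) = (z + 1 / 2) + l * τ + μ := by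
    rw [hμ]; push_cast; ring
  have C : jacobiThetaKW (z / (((2 * l : ℤ) : ℂ) * τ + d) + 1 / 2)
      (((a : ℂ) * τ + b) / (((2 * l : ℤ) : ℂ) * τ + d)) ^ 2 =
      s * ε * (((2 * l : ℤ) : ℂ) * τ + d) *
      Complex.exp (2 * π * Complex.I * (2 * l : ℤ) * z ^ 2 / (((2 * l : ℤ) : ℂ) * τ + d)) *
      jacobiThetaKW (z + 1 / 2) τ ^ 2 := by
    have e1 : z / (((2 * l : ℤ) : ℂ) * τ + d) + 1 / 2 =
      (z + (((2 * l : ℤ) : ℂ) * τ + d) / 2) / (((2 * l : ℤ) : ℂ) * τ + d) := by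
      field_simp
    rw [e1, B]
    nth_rewrite 2 [e0]
    rw [kw_shift, mul_pow, ← Complex.exp_nat_mul]
    have e2 : Complex.exp (2 * π * Complex.I * (2 * l : ℤ) *
        (z + (((2 * l : ℤ) : ℂ) * τ + d) / 2) ^ 2 / (((2 * l : ℤ) : ℂ) * τ + d)) *
        Complex.exp (((2 : ℕ) : ℂ) * (-π * Complex.I * l ^ 2 * τ
          - 2 * π * Complex.I * l * (z + 1 / 2 + 1 / 2) + π * Complex.I * μ)) =
        s * Complex.exp (2 * π * Complex.I * (2 * l : ℤ) * z ^ 2 / (((2 * l : ℤ) : ℂ) * τ + d)) := by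
      rw [hs, ← Complex.exp_add, ← Complex.exp_add, Complex.exp_eq_exp_iff_exists_int]
      refine ⟨μ - 2 * l, ?_⟩
      set j := ((2 * l : ℤ) : ℂ) * τ + d with hjd
      have e3 : 2 * π * Complex.I * (2 * l : ℤ) * (z + j / 2) ^ 2 / j =
        2 * π * Complex.I * (2 * l : ℤ) * z ^ 2 / j + 2 * π * Complex.I * (2 * l : ℤ) * z
          + 2 * π * Complex.I * (2 * l : ℤ) * j / 4 := by
        field_simp; ring
      rw [e3, hjd]
      push_cast
      ring
    linear_combination (ε * (((2 * l : ℤ) : ℂ) * τ + d) * jacobiThetaKW (z + 1 / 2) τ ^ 2) * e2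
  unfold phiKW
  rw [← two_mul r, ← two_mul k, pow_mul, pow_mul, pow_mul, pow_mul, A, C]
  have hx : Complex.exp (π * Complex.I * (2 * l : ℤ) * (((2 * r : ℕ) : ℂ) - (2 * k : ℕ)) * z ^ 2 /
      (((2 * l : ℤ) : ℂ) * τ + d)) =
      Complex.exp (2 * π * Complex.I * (2 * l : ℤ) * z ^ 2 / (((2 * l : ℤ) : ℂ) * τ + d)) ^ r /
      Complex.exp (2 * π * Complex.I * (2 * l : ℤ) * z ^ 2 / (((2 * l : ℤ) : ℂ) * τ + d)) ^ k := by
    rw [← Complex.exp_nat_mul, ← Complex.exp_nat_mul, ← Complex.exp_sub]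
    congr 1; push_cast; ring
  have hp : (2 * r - 2 * k) / 2 = r - k := by omega
  rw [hx, hp, pow_sub₀ _ hj (by omega)]
  simp only [mul_pow, div_eq_mul_inv, mul_inv]
  ring
end

section
/- For every τ ∈ ℍ, the derivative of the Jacobi theta function in its first variable at z = 0 satisfies ϑ'(0;τ) = −2π η(τ)³. -/
open Real

section aux

noncomputable def uu (q : ℂ) (n : ℕ) : ℂ := ∏ k ∈ Finset.range n, (1 - q ^ (k + 1))

noncomputable def rr (q : ℂ) (k : ℤ) : ℂ := if 0 ≤ k then (uu q k.toNat)⁻¹ else 0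

lemma one_sub_ne {q : ℂ} (hq : ‖q‖ < 1) (k : ℕ) : 1 - q ^ (k + 1) ≠ 0 := by
  intro h
  have h1 : q ^ (k + 1) = 1 := (sub_eq_zero.mp h).symm
  have h2 : ‖q‖ ^ (k + 1) = 1 := by rw [← norm_pow, h1, norm_one]
  have h3 : ‖q‖ ^ (k + 1) < 1 := pow_lt_one₀ (norm_nonneg _) hq (by omega)
  linarith

lemma uu_ne {q : ℂ} (hq : ‖q‖ < 1) (n : ℕ) : uu q n ≠ 0 :=
  Finset.prod_ne_zero_iff.mpr fun k _ => one_sub_ne hq k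

lemma uu_succ (q : ℂ) (n : ℕ) : uu q (n + 1) = uu q n * (1 - q ^ (n + 1)) :=
  Finset.prod_range_succ _ _

lemma rr_rec {q : ℂ} (hq : ‖q‖ < 1) (k : ℤ) : rr q (k - 1) = (1 - q ^ k) * rr q k := by
  rcases lt_trichotomy k 0 with h | h | h
  · simp [rr, show ¬ (0 ≤ k) by omega, show ¬ (1 ≤ k) by omega]
  · subst h; simp [rr]
  · obtain ⟨n, rfl⟩ : ∃ n : ℕ, k = n + 1 := ⟨(k - 1).toNat, by omega⟩
    have h1 := one_sub_ne hq n
    have h2 := uu_ne hq n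
    have e : ((n : ℤ) + 1).toNat = n + 1 := by omega
    simp only [rr, add_sub_cancel_right, Int.natCast_nonneg, if_true, Int.toNat_natCast, e,
      show (0 : ℤ) ≤ n + 1 by omega, uu_succ]
    have : q ^ ((n : ℤ) + 1) = q ^ (n + 1) := by exact_mod_cast zpow_natCast q (n + 1)
    rw [this]
    field_simp

noncomputable def cc (q : ℂ) (w : ℤ → ℂ) (n : ℕ) (m : ℤ) : ℂ :=
  w m * rr q (n - m) * rr q (n + m + 1) * uu q (2 * n + 1)

lemma cc_rec {q : ℂ} (hq : ‖q‖ < 1) (q0 : q ≠ 0) (w : ℤ → ℂ)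
    (hw : ∀ m, w (m + 1) = - q ^ (m + 1) * w m) (n : ℕ) (m : ℤ) :
    cc q w (n + 1) m = (1 + (q ^ (n + 1)) ^ 2) * cc q w n m
      - q ^ (n + 1) * (cc q w n (m - 1) + cc q w n (m + 1)) := by
  have hw' : w (m - 1) = - (q ^ m)⁻¹ * w m := by
    have := hw (m - 1)
    rw [sub_add_cancel] at this
    rw [this]
    have : q ^ m ≠ 0 := zpow_ne_zero _ q0
    field_simp
  simp only [cc, hw, hw']
  have a1 : rr q ((n : ℤ) - m) = (1 - q ^ ((n : ℤ) + 1 - m)) * rr q ((n : ℤ) + 1 - m) := by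
    rw [← rr_rec hq]; congr 1; ring
  have a2 : rr q ((n : ℤ) - (m + 1)) = (1 - q ^ ((n : ℤ) - m)) * rr q ((n : ℤ) - m) := by
    rw [← rr_rec hq]; congr 1; ring
  have b1 : rr q ((n : ℤ) + m + 1) = (1 - q ^ ((n : ℤ) + m + 2)) * rr q ((n : ℤ) + m + 2) := by
    rw [← rr_rec hq]; congr 1; ring
  have b2 : rr q ((n : ℤ) + m) = (1 - q ^ ((n : ℤ) + m + 1)) * rr q ((n : ℤ) + m + 1) := by
    rw [← rr_rec hq]; congr 1; ring
  have e1 : ((n + 1 : ℕ) : ℤ) - m = (n : ℤ) + 1 - m := by push_cast; ring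
  have e2 : ((n + 1 : ℕ) : ℤ) + m + 1 = (n : ℤ) + m + 2 := by push_cast; ring
  have e3 : (n : ℤ) - (m - 1) = (n : ℤ) + 1 - m := by ring
  have e4 : (n : ℤ) + (m - 1) + 1 = (n : ℤ) + m := by ring
  have e5 : (n : ℤ) + (m + 1) + 1 = (n : ℤ) + m + 2 := by ring
  rw [e1, e2, e3, e4, e5, a2, a1, b2, b1, show 2 * (n + 1) + 1 = 2 * n + 1 + 1 + 1 by ring,
    uu_succ, uu_succ]
  generalize rr q ((n : ℤ) + 1 - m) = A
  generalize rr q ((n : ℤ) + m + 2) = B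
  generalize uu q (2 * n + 1) = D
  have f1 : q ^ ((n : ℤ) + 1 - m) = q ^ n * q / q ^ m := by
    rw [zpow_sub₀ q0, zpow_add₀ q0]; simp
  have f2 : q ^ ((n : ℤ) - m) = q ^ n / q ^ m := by
    rw [zpow_sub₀ q0]; simp
  have f3 : q ^ ((n : ℤ) + m + 2) = q ^ n * q ^ m * q ^ 2 := by
    rw [zpow_add₀ q0, zpow_add₀ q0]; norm_cast
  have f4 : q ^ ((n : ℤ) + m + 1) = q ^ n * q ^ m * q := by
    rw [zpow_add₀ q0, zpow_add₀ q0]; simp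
  have f5 : q ^ (m + 1) = q ^ m * q := by rw [zpow_add₀ q0]; simp
  rw [f1, f2, f3, f4, f5, show q ^ (2 * n + 1 + 1) = (q ^ n) ^ 2 * q ^ 2 by ring,
    show q ^ (2 * n + 1 + 1 + 1) = (q ^ n) ^ 2 * q ^ 3 by ring, pow_succ q n]
  have hY : q ^ m ≠ 0 := zpow_ne_zero _ q0
  generalize q ^ m = Y at *
  generalize q ^ n = X at *
  field_simp
  ring

lemma cc_zero (q : ℂ) (w : ℤ → ℂ) (n : ℕ) (m : ℤ) (hm : m ∉ Finset.Icc (-(n : ℤ) - 1) n) :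
    cc q w n m = 0 := by
  rw [Finset.mem_Icc, not_and_or] at hm
  rcases hm with h | h
  · have : ¬ (0 ≤ (n : ℤ) + m + 1) := by omega
    simp only [cc, rr, this, if_false]; ring
  · have : ¬ (0 ≤ (n : ℤ) - m) := by omega
    simp only [cc, rr, this, if_false]; ring

lemma cc_summable (q : ℂ) (w : ℤ → ℂ) (n : ℕ) (a : ℤ → ℂ) :
    Summable fun m => a m * cc q w n m :=
  summable_of_ne_finset_zero (s := Finset.Icc (-(n : ℤ) - 1) n)
    fun m hm => by rw [cc_zero q w n m hm, mul_zero]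

lemma cc_sum {q : ℂ} (hq : ‖q‖ < 1) (q0 : q ≠ 0) (w : ℤ → ℂ)
    (hw : ∀ m, w (m + 1) = - q ^ (m + 1) * w m) (w0 : w 0 = 1) (n : ℕ) :
    ∑' m : ℤ, (2 * m + 1 : ℂ) * cc q w n m = 2 * uu q n ^ 2 := by
  induction n with
  | zero =>
    have hw1 : w (-1) = -1 := by
      have := hw (-1)
      simp [w0] at this
      rw [this]; ring
    rw [tsum_eq_sum (s := Finset.Icc (-1 : ℤ) 0)
      (fun m hm => by rw [cc_zero q w 0 m (by simpa using hm), mul_zero])]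
    have : Finset.Icc (-1 : ℤ) 0 = {-1, 0} := by decide
    have h1 := one_sub_ne hq 0
    simp only [zero_add, pow_one] at h1
    rw [this]
    simp [cc, rr, uu, w0, hw1]
    field_simp
    norm_num
  | succ n ih =>
    have S := cc_summable q w n
    set C := cc q w n with hC
    have s1 : Summable fun m : ℤ => (2 * m + 1 : ℂ) * C (m - 1) := by
      have := (Equiv.subRight (1 : ℤ)).summable_iff.mpr (S fun m => 2 * m + 3)
      refine this.congr fun m => ?_
      simp; left; ring
    have s2 : Summable fun m : ℤ => (2 * m + 1 : ℂ) * C (m + 1) := by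
      have := (Equiv.addRight (1 : ℤ)).summable_iff.mpr (S fun m => 2 * m - 1)
      refine this.congr fun m => ?_
      simp; left; ring
    have t1 : ∑' m : ℤ, (2 * m + 1 : ℂ) * C (m - 1) = ∑' m : ℤ, (2 * m + 3 : ℂ) * C m := by
      rw [← (Equiv.subRight (1 : ℤ)).tsum_eq (fun m : ℤ => (2 * m + 3 : ℂ) * C m)]
      refine tsum_congr fun m => ?_
      simp; left; ring
    have t2 : ∑' m : ℤ, (2 * m + 1 : ℂ) * C (m + 1) = ∑' m : ℤ, (2 * m - 1 : ℂ) * C m := by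
      rw [← (Equiv.addRight (1 : ℤ)).tsum_eq (fun m : ℤ => (2 * m - 1 : ℂ) * C m)]
      refine tsum_congr fun m => ?_
      simp; left; ring
    have t3 : ∑' m : ℤ, (2 * m + 3 : ℂ) * C m + ∑' m : ℤ, (2 * m - 1 : ℂ) * C m
        = 2 * ∑' m : ℤ, (2 * m + 1 : ℂ) * C m := by
      rw [← (S _).tsum_add (S _), ← tsum_mul_left]
      exact tsum_congr fun m => by ring
    have : ∀ m : ℤ, (2 * m + 1 : ℂ) * cc q w (n + 1) m
        = (1 + (q ^ (n + 1)) ^ 2) * ((2 * m + 1 : ℂ) * C m)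
          - q ^ (n + 1) * ((2 * m + 1 : ℂ) * C (m - 1) + (2 * m + 1 : ℂ) * C (m + 1)) := by
      intro m
      rw [cc_rec hq q0 w hw]; ring
    rw [tsum_congr this, ((S _).mul_left _).tsum_sub ((s1.add s2).mul_left _), tsum_mul_left,
      tsum_mul_left, s1.tsum_add s2, t1, t2, t3, ih, uu_succ]
    ring

open Filter Topology in
lemma jacobi_id {q : ℂ} (hq : ‖q‖ < 1) (q0 : q ≠ 0) (w : ℤ → ℂ)
    (hw : ∀ m, w (m + 1) = - q ^ (m + 1) * w m) (w0 : w 0 = 1)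
    (hs : Summable fun m : ℤ => (2 * m + 1 : ℂ) * w m) :
    ∑' m : ℤ, (2 * m + 1 : ℂ) * w m = 2 * (∏' k : ℕ, (1 - q ^ (k + 1))) ^ 3 := by
  set P := ∏' k : ℕ, (1 - q ^ (k + 1)) with hP
  have P0 : P ≠ 0 := by
    have := tprod_one_add_ne_zero_of_summable (f := fun n : ℕ ↦ -q ^ (n + 1))
      (fun i => by simpa [sub_eq_add_neg] using one_sub_ne hq i)
      (by simpa using (summable_nat_add_iff 1).mpr
            (summable_geometric_of_lt_one (norm_nonneg _) hq))
    simpa [hP, sub_eq_add_neg] using this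
  have hu : Tendsto (uu q) atTop (𝓝 P) :=
    (ModularForm.multipliable_one_sub_pow hq).hasProd.tendsto_prod_nat
  have hui : Tendsto (fun n => (uu q n)⁻¹) atTop (𝓝 P⁻¹) := hu.inv₀ P0
  have hr : Tendsto (rr q) atTop (𝓝 P⁻¹) := by
    have h1 : Tendsto (fun k : ℤ => (uu q k.toNat)⁻¹) atTop (𝓝 P⁻¹) :=
      hui.comp (tendsto_atTop_atTop.mpr fun b => ⟨b, fun a ha => by omega⟩)
    refine h1.congr' ?_
    filter_upwards [eventually_ge_atTop 0] with k hk
    simp [rr, hk]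
  obtain ⟨A, hA⟩ := hu.norm.bddAbove_range
  obtain ⟨B, hB⟩ := hui.norm.bddAbove_range
  have hA' : ∀ n, ‖uu q n‖ ≤ A := fun n => hA ⟨n, rfl⟩
  have hB0 : 0 ≤ B := (norm_nonneg _).trans (hB ⟨0, rfl⟩)
  have hB' : ∀ k, ‖rr q k‖ ≤ B := by
    intro k
    unfold rr
    split_ifs with h
    · exact hB ⟨k.toNat, rfl⟩
    · simpa using hB0
  have L : Tendsto (fun n : ℕ => ∑' m : ℤ, (2 * m + 1 : ℂ) * cc q w n m) atTop
      (𝓝 (∑' m : ℤ, (2 * m + 1 : ℂ) * (w m * P⁻¹ * P⁻¹ * P))) := by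
    refine tendsto_tsum_of_dominated_convergence
      (bound := fun m : ℤ => ‖(2 * m + 1 : ℂ) * w m‖ * (B * B * A))
      (hs.norm.mul_right _) (fun m => ?_) (Eventually.of_forall fun n m => ?_)
    · have n1 : Tendsto (fun n : ℕ => rr q ((n : ℤ) - m)) atTop (𝓝 P⁻¹) :=
        hr.comp (tendsto_atTop_atTop.mpr fun b => ⟨(b + m).toNat, fun a ha => by omega⟩)
      have n2 : Tendsto (fun n : ℕ => rr q ((n : ℤ) + m + 1)) atTop (𝓝 P⁻¹) :=
        hr.comp (tendsto_atTop_atTop.mpr fun b => ⟨(b - m).toNat, fun a ha => by omega⟩)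
      have n3 : Tendsto (fun n : ℕ => uu q (2 * n + 1)) atTop (𝓝 P) :=
        hu.comp (tendsto_atTop_atTop.mpr fun b => ⟨b, fun a ha => by omega⟩)
      exact (((n1.const_mul (w m)).mul n2).mul n3).const_mul _
    · have : (2 * m + 1 : ℂ) * cc q w n m = ((2 * m + 1 : ℂ) * w m) *
        (rr q (n - m) * rr q (n + m + 1) * uu q (2 * n + 1)) := by unfold cc; ring
      rw [this, norm_mul, norm_mul (_ * _) (uu _ _), norm_mul (rr _ _)]
      gcongr
      · exact hB' _
      · exact hB' _
      · exact hA' _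
  have L2 : Tendsto (fun n : ℕ => ∑' m : ℤ, (2 * m + 1 : ℂ) * cc q w n m) atTop
      (𝓝 (2 * P ^ 2)) := by
    simp_rw [cc_sum hq q0 w hw w0]
    exact (hu.pow 2).const_mul 2
  have E := tendsto_nhds_unique L L2
  have : ∀ m : ℤ, (2 * m + 1 : ℂ) * (w m * P⁻¹ * P⁻¹ * P) = ((2 * m + 1 : ℂ) * w m) * P⁻¹ := by
    intro m; field_simp
  rw [tsum_congr this, tsum_mul_right] at E
  field_simp at E
  rw [E]

end aux

/-- For every `τ ∈ ℍ`, the derivative of the Jacobi theta function in its first variable at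
`z = 0` satisfies `ϑ'(0;τ) = −2π η(τ)³`. -/
theorem stmt_9 (τ : ℂ) (hτ : 0 < τ.im) :
    deriv (fun z : ℂ => jacobiThetaKW z τ) 0 = -2 * π * dedekindEta τ ^ 3 := by
  set q : ℂ := Complex.exp (2 * π * Complex.I * τ) with hqd
  have q0 : q ≠ 0 := Complex.exp_ne_zero _
  have hq : ‖q‖ < 1 := UpperHalfPlane.norm_exp_two_pi_I_lt_one ⟨τ, hτ⟩
  set z₀ : ℂ := 1 / 2 + τ / 2 with hz₀
  set w : ℤ → ℂ := fun m => jacobiTheta₂_term m z₀ τ with hwd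
  have w0 : w 0 = 1 := by simp [hwd, jacobiTheta₂_term]
  have hw : ∀ m, w (m + 1) = - q ^ (m + 1) * w m := by
    intro m
    have : q ^ (m + 1) = Complex.exp (((m + 1 : ℤ) : ℂ) * (2 * π * Complex.I * τ)) := by
      rw [Complex.exp_int_mul]
    rw [this]
    simp only [hwd, jacobiTheta₂_term]
    rw [neg_mul, ← Complex.exp_add, ← Complex.exp_add_pi_mul_I]
    congr 1
    rw [hz₀]
    push_cast
    ring
  have hd := hasSum_jacobiTheta₂'_term z₀ hτ
  have ht := hasSum_jacobiTheta₂_term z₀ hτ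
  have hsum : HasSum (fun m : ℤ => (π * Complex.I) * ((2 * m + 1 : ℂ) * w m))
      (π * Complex.I * jacobiTheta₂ z₀ τ + jacobiTheta₂' z₀ τ) := by
    refine ((ht.mul_left (π * Complex.I)).add hd).congr_fun ?_ 
    intro m
    simp only [jacobiTheta₂'_term, hwd]; ring
  have pi0 : (π * Complex.I : ℂ) ≠ 0 := by simp [Real.pi_ne_zero]
  have hs : Summable fun m : ℤ => (2 * m + 1 : ℂ) * w m :=
    (summable_mul_left_iff pi0).mp hsum.summable
  have J := jacobi_id hq q0 w hw w0 hs
  have hfun : (fun z : ℂ => jacobiThetaKW z τ) = fun z =>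
      Complex.exp (π * Complex.I * τ / 4 + π * Complex.I * (z + 1 / 2)) *
        jacobiTheta₂ (z + z₀) τ := by
    funext z
    rw [jacobiThetaKW, jacobiTheta₂, ← tsum_mul_left]
    refine tsum_congr fun n => ?_
    rw [jacobiTheta₂_term, ← Complex.exp_add, hz₀]
    congr 1
    ring
  have D1 : HasDerivAt (fun z : ℂ => Complex.exp (π * Complex.I * τ / 4 +
      π * Complex.I * (z + 1 / 2)))
      (Complex.exp (π * Complex.I * τ / 4 + π * Complex.I * (0 + 1 / 2)) *
        (π * Complex.I * 1)) 0 :=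
    ((((hasDerivAt_id (0 : ℂ)).add_const _).const_mul _).const_add _).cexp
  have D2 : HasDerivAt (fun z : ℂ => jacobiTheta₂ (z + z₀) τ) (jacobiTheta₂' z₀ τ) 0 := by
    refine HasDerivAt.comp_add_const (f := fun z => jacobiTheta₂ z τ) 0 z₀ ?_
    simpa using hasDerivAt_jacobiTheta₂_fst z₀ hτ
  rw [hfun, (D1.fun_mul D2).deriv]
  have hE : ∏' k : ℕ, (1 - Complex.exp (2 * π * Complex.I * τ * ((k : ℂ) + 1)))
      = ∏' k : ℕ, (1 - q ^ (k + 1)) := by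
    refine tprod_congr fun k => ?_
    rw [hqd, ← Complex.exp_nat_mul]
    congr 2
    push_cast
    ring
  have hv := hsum.tsum_eq
  rw [tsum_mul_left, J] at hv
  rw [dedekindEta, hE, mul_pow, ← Complex.exp_nat_mul]
  have e1 : Complex.exp (π * Complex.I * τ / 4 + π * Complex.I * (0 + 1 / 2))
      = Complex.exp (((3 : ℕ) : ℂ) * (π * Complex.I * τ / 12)) * Complex.I := by
    rw [Complex.exp_add]
    congr 1
    · congr 1; push_cast; ring
    · refine Eq.trans ?_ Complex.exp_pi_div_two_mul_I
      congr 1; ring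
  rw [e1, zero_add]
  linear_combination (Complex.exp (((3 : ℕ) : ℂ) * (π * Complex.I * τ / 12)) * Complex.I) * (-hv)
    + 2 * π * Complex.exp (((3 : ℕ) : ℂ) * (π * Complex.I * τ / 12)) * (∏' k : ℕ, (1 - q ^ (k + 1))) ^ 3 * Complex.I_sq
end

section
/- For every τ ∈ ℍ one has (1/(2πi)²) · ϑ''(1/2; τ)/ϑ(1/2; τ) = −(1/12) E₂(τ) + (1/3) E₂(2τ), where ϑ''(1/2;τ) denotes the second derivative of ϑ(z;τ) in z evaluated at z = 1/2. -/
open Real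

/-- The quasimodular Eisenstein series `E₂(τ) := 1 − 24 ∑_{k=1}^∞ σ₁(k) q^k`, `q = e^{2πiτ}`. -/
noncomputable def eisensteinE2 (τ : ℂ) : ℂ :=
  1 - 24 * ∑' k : ℕ, ((ArithmeticFunction.sigma 1) (k + 1) : ℂ) *
      Complex.exp (2 * π * Complex.I * τ * ((k : ℂ) + 1))


noncomputable def gP (x : ℂ) (n : ℕ) : ℂ :=
  ∏ k ∈ Finset.range n, (1 - x ^ (2 * k + 2)) / (1 - x ^ (2 * k + 1))

lemma one_sub_pow_ne (x : ℂ) (hx : ‖x‖ < 1) (k : ℕ) : 1 - x ^ (k + 1) ≠ 0 := by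
  intro h
  have h1 : ‖x ^ (k + 1)‖ = 1 := by
    rw [← sub_eq_zero.mp h]; simp
  rw [norm_pow] at h1
  have := pow_lt_one₀ (norm_nonneg x) hx (n := k + 1) (by omega)
  linarith

lemma gP_succ (x : ℂ) (n : ℕ) :
    gP x (n + 1) = gP x n * ((1 - x ^ (2 * n + 2)) / (1 - x ^ (2 * n + 1))) := by
  rw [gP, Finset.prod_range_succ, ← gP]

lemma gP_ne (x : ℂ) (hx : ‖x‖ < 1) (n : ℕ) : gP x n ≠ 0 :=
  Finset.prod_ne_zero_iff.mpr fun k _ =>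
    div_ne_zero (one_sub_pow_ne x hx (2 * k + 1)) (one_sub_pow_ne x hx (2 * k))

lemma gauss_tele (x : ℂ) (hx : ‖x‖ < 1) (n m : ℕ) :
    ∑ s ∈ Finset.range (m + 1), (x ^ (s * (2 * n + 3)) * (1 - x ^ (2 * n + 2))
      - (1 - x ^ (2 * n + 1)) * x ^ (s * (2 * n + 1))) / gP x s
    = x ^ ((m + 1) * (2 * n + 1)) * (1 - x ^ (2 * m + 1)) / gP x m := by
  induction m with
  | zero => simp [gP]; ring
  | succ m ih =>
    rw [Finset.sum_range_succ, ih, gP_succ]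
    have h1 := gP_ne x hx m
    have h2 := one_sub_pow_ne x hx (2 * m)
    have h3 := one_sub_pow_ne x hx (2 * m + 1)
    have h4 : 1 - x ^ (2 * m + 2) ≠ 0 := h3
    field_simp
    ring

lemma gauss_finite (x : ℂ) (hx : ‖x‖ < 1) (n : ℕ) :
    ∑ s ∈ Finset.range (n + 1), gP x n / gP x s * x ^ (s * (2 * n + 1))
      = ∑ s ∈ Finset.range (2 * n + 1), x ^ (s * (s + 1) / 2) := by
  induction n with
  | zero => simp [gP]
  | succ n ih =>
    have e1 : (2 * n + 1) * (2 * n + 1 + 1) / 2 = (n + 1) * (2 * n + 1) := by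
      rw [show (2 * n + 1) * (2 * n + 1 + 1) = 2 * ((n + 1) * (2 * n + 1)) by ring]; simp
    have e2 : (2 * n + 2) * (2 * n + 2 + 1) / 2 = (n + 1) * (2 * n + 3) := by
      rw [show (2 * n + 2) * (2 * n + 2 + 1) = 2 * ((n + 1) * (2 * n + 3)) by ring]; simp
    rw [show 2 * (n + 1) + 1 = 2 * n + 1 + 1 + 1 by ring, Finset.sum_range_succ _ (2 * n + 1 + 1),
      Finset.sum_range_succ _ (2 * n + 1), ← ih, e1, e2, Finset.sum_range_succ _ (n + 1),
      div_self (gP_ne x hx _), one_mul]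
    congr 1
    rw [← sub_eq_iff_eq_add', ← Finset.sum_sub_distrib]
    have h2 := one_sub_pow_ne x hx (2 * n)
    have := gauss_tele x hx n n
    have h1 := gP_ne x hx n
    calc _ = ∑ s ∈ Finset.range (n + 1), gP x n / (1 - x ^ (2 * n + 1)) *
          ((x ^ (s * (2 * n + 3)) * (1 - x ^ (2 * n + 2))
      - (1 - x ^ (2 * n + 1)) * x ^ (s * (2 * n + 1))) / gP x s) := by
            refine Finset.sum_congr rfl fun s _ => ?_
            have h3 := gP_ne x hx s
            rw [gP_succ]
            field_simp
      _ = _ := by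
        rw [← Finset.mul_sum, this]
        field_simp

lemma gP_eq (x : ℂ) (hx : ‖x‖ < 1) (n : ℕ) :
    gP x n = (∏ k ∈ Finset.range n, (1 - (x ^ 2) ^ (k + 1))) ^ 2 /
      ∏ k ∈ Finset.range (2 * n), (1 - x ^ (k + 1)) := by
  induction n with
  | zero => simp [gP]
  | succ n ih =>
    rw [gP_succ, ih, show 2 * (n + 1) = 2 * n + 1 + 1 by ring, Finset.prod_range_succ _ n,
      Finset.prod_range_succ _ (2 * n + 1), Finset.prod_range_succ _ (2 * n)]
    have h2 := one_sub_pow_ne x hx (2 * n)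
    have h3 := one_sub_pow_ne x hx (2 * n + 1)
    have h4 : ∏ k ∈ Finset.range (2 * n), (1 - x ^ (k + 1)) ≠ 0 :=
      Finset.prod_ne_zero_iff.mpr fun k _ => one_sub_pow_ne x hx k
    rw [← pow_mul, show 2 * (n + 1) = 2 * n + 1 + 1 by ring]
    rw [show 2 * n + 2 = 2 * n + 1 + 1 by ring]
    field_simp

lemma tprod_pow_ne (x : ℂ) (hx : ‖x‖ < 1) : ∏' k : ℕ, (1 - x ^ (k + 1)) ≠ 0 := by
  have := tprod_one_add_ne_zero_of_summable (f := fun n : ℕ ↦ -x ^ (n + 1))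
    (fun i => by simpa [← sub_eq_add_neg] using one_sub_pow_ne x hx i)
    (by simpa using (summable_nat_add_iff 1).mpr (summable_geometric_of_lt_one (norm_nonneg _) hx))
  simpa [← sub_eq_add_neg] using this

lemma gP_tendsto (x : ℂ) (hx : ‖x‖ < 1) :
    Filter.Tendsto (gP x) Filter.atTop (nhds ((∏' k : ℕ, (1 - (x ^ 2) ^ (k + 1))) ^ 2 /
      ∏' k : ℕ, (1 - x ^ (k + 1)))) := by
  have hx2 : ‖x ^ 2‖ < 1 := by
    rw [norm_pow]; exact pow_lt_one₀ (norm_nonneg x) hx two_ne_zero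
  have h1 := (ModularForm.multipliable_one_sub_pow hx2).hasProd.tendsto_prod_nat
  have h2 := (ModularForm.multipliable_one_sub_pow hx).hasProd.tendsto_prod_nat
  have h3 : Filter.Tendsto (fun n : ℕ => 2 * n) Filter.atTop Filter.atTop :=
    Filter.tendsto_atTop_mono (fun n => by simp only [id]; omega) Filter.tendsto_id
  refine ((h1.pow 2).div (h2.comp h3) (tprod_pow_ne x hx)).congr fun n => ?_
  rw [gP_eq x hx]
  rfl

lemma summable_tri (x : ℂ) (hx : ‖x‖ < 1) : Summable fun s : ℕ => x ^ (s * (s + 1) / 2) := by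
  refine Summable.of_norm_bounded (summable_geometric_of_lt_one (norm_nonneg _) hx) fun s => ?_
  rw [norm_pow]
  refine pow_le_pow_of_le_one (norm_nonneg _) hx.le ?_
  rw [Nat.le_div_iff_mul_le two_pos]
  rcases s with _ | s
  · simp
  · nlinarith

lemma gauss_tri (x : ℂ) (hx : ‖x‖ < 1) :
    ∑' s : ℕ, x ^ (s * (s + 1) / 2) = (∏' k : ℕ, (1 - (x ^ 2) ^ (k + 1))) ^ 2 /
      ∏' k : ℕ, (1 - x ^ (k + 1)) := by
  have hx2 : ‖x ^ 2‖ < 1 := by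
    rw [norm_pow]; exact pow_lt_one₀ (norm_nonneg x) hx two_ne_zero
  have h1 := gP_tendsto x hx
  set L := (∏' k : ℕ, (1 - (x ^ 2) ^ (k + 1))) ^ 2 / ∏' k : ℕ, (1 - x ^ (k + 1)) with hL
  have hL0 : L ≠ 0 := div_ne_zero (pow_ne_zero _ (tprod_pow_ne _ hx2)) (tprod_pow_ne x hx)
  obtain ⟨A, hA⟩ := h1.norm.bddAbove_range
  obtain ⟨B, hB⟩ := (h1.inv₀ hL0).norm.bddAbove_range
  have hA' : ∀ n, ‖gP x n‖ ≤ A := fun n => hA ⟨n, rfl⟩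
  have hB' : ∀ n, ‖(gP x n)⁻¹‖ ≤ B := fun n => hB ⟨n, rfl⟩
  have hA0 : 0 ≤ A := (norm_nonneg _).trans (hA' 0)
  have hB0 : 0 ≤ B := (norm_nonneg _).trans (hB' 0)
  have h3 : Filter.Tendsto (fun n : ℕ => 2 * n + 1) Filter.atTop Filter.atTop :=
    Filter.tendsto_atTop_mono (fun n => by simp only [id]; omega) Filter.tendsto_id
  have h2 := (summable_tri x hx).hasSum.tendsto_sum_nat.comp h3
  refine tendsto_nhds_unique h2 ?_
  have h4 : Filter.Tendsto (fun n : ℕ => ∑ s ∈ Finset.range n,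
      gP x n / gP x (s + 1) * x ^ ((s + 1) * (2 * n + 1))) Filter.atTop (nhds 0) := by
    have h5 := (tendsto_self_mul_const_pow_of_lt_one (norm_nonneg x) hx).const_mul (A * B)
    rw [mul_zero] at h5
    refine squeeze_zero_norm (fun n => ?_) h5
    refine (norm_sum_le _ _).trans ?_
    refine (Finset.sum_le_card_nsmul _ _ (A * B * ‖x‖ ^ n) fun s _ => ?_).trans ?_
    · rw [div_eq_mul_inv, norm_mul, norm_mul, norm_pow]
      have := hA' n
      have := hB' (s + 1)
      have : ‖x‖ ^ ((s + 1) * (2 * n + 1)) ≤ ‖x‖ ^ n :=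
        pow_le_pow_of_le_one (norm_nonneg _) hx.le (by nlinarith)
      gcongr
    · simp; apply le_of_eq; ring
  have h6 := h4.add h1
  rw [zero_add] at h6
  refine h6.congr fun n => ?_
  simp only [Function.comp]
  rw [← gauss_finite x hx n, Finset.sum_range_succ']
  simp [gP]

lemma hs_congr {ι : Type*} {f g : ι → ℂ} {a : ℂ} (h : HasSum f a) (hfg : ∀ n, g n = f n) :
    HasSum g a := by
  rw [funext hfg]; exact h

lemma kw_term_norm (z τ : ℂ) (n : ℤ) :
    ‖Complex.exp (π * Complex.I * ((n : ℂ) + 1 / 2) ^ 2 * τ +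
      2 * π * Complex.I * ((n : ℂ) + 1 / 2) * (z + 1 / 2))‖ =
    Real.exp (-π * ((n : ℝ) + 1 / 2) ^ 2 * τ.im - 2 * π * ((n : ℝ) + 1 / 2) * z.im) := by
  rw [Complex.norm_exp]
  congr 1
  have : (π * Complex.I * ((n : ℂ) + 1 / 2) ^ 2 * τ +
      2 * π * Complex.I * ((n : ℂ) + 1 / 2) * (z + 1 / 2)) =
      Complex.I * (((π * ((n : ℝ) + 1 / 2) ^ 2 : ℝ) : ℂ) * τ
        + ((2 * π * ((n : ℝ) + 1 / 2) : ℝ) : ℂ) * (z + ((1 / 2 : ℝ) : ℂ))) := by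
    push_cast; ring
  rw [this, Complex.I_mul_re, Complex.add_im, Complex.im_ofReal_mul, Complex.im_ofReal_mul,
    Complex.add_im, Complex.ofReal_im]
  ring

noncomputable def kwB (T : ℝ) (n : ℤ) : ℝ :=
  Real.exp (-π * (T * (n : ℝ) ^ 2 - 2 * (T / 2 + 1) * |(n : ℝ)|) + π)

lemma kwB_summable {T : ℝ} (hT : 0 < T) : Summable (kwB T) := by
  have := (summable_pow_mul_jacobiTheta₂_term_bound (T / 2 + 1) hT 0).mul_right (Real.exp π)
  refine this.congr fun n => ?_
  rw [kwB, Real.exp_add]; simp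

lemma kw_bound {T : ℝ} (hT : 0 < T) (z τ : ℂ) (h1 : T ≤ τ.im) (h2 : |z.im| ≤ 1) (n : ℤ) :
    ‖Complex.exp (π * Complex.I * ((n : ℂ) + 1 / 2) ^ 2 * τ +
      2 * π * Complex.I * ((n : ℂ) + 1 / 2) * (z + 1 / 2))‖ ≤ kwB T n := by
  rw [kw_term_norm, kwB, Real.exp_le_exp]
  have hp := Real.pi_pos
  set m : ℝ := (n : ℝ)
  have a1 : T * (m + 1 / 2) ^ 2 ≤ (m + 1 / 2) ^ 2 * τ.im := by nlinarith [sq_nonneg (m + 1 / 2)]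
  have a2 : -(2 * (m + 1 / 2) * z.im) ≤ 2 * |m| + 1 := by
    have : |2 * (m + 1 / 2) * z.im| ≤ 2 * |m| + 1 := by
      rw [abs_mul, abs_mul, abs_two]
      have : |m + 1 / 2| ≤ |m| + 1 / 2 := (abs_add_le _ _).trans (by norm_num [abs_of_pos])
      nlinarith [abs_nonneg (m + 1 / 2), abs_nonneg m]
    linarith [neg_abs_le (2 * (m + 1 / 2) * z.im)]
  have a3 : T * (m + 1 / 2) ^ 2 ≥ T * m ^ 2 - T * |m| := by nlinarith [neg_abs_le m]
  nlinarith

lemma kw_deriv_tau (τ : ℂ) (hτ : 0 < τ.im) :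
    HasSum (fun n : ℤ => π * Complex.I * ((n : ℂ) + 1 / 2) ^ 2 *
      Complex.exp (π * Complex.I * ((n : ℂ) + 1 / 2) ^ 2 * τ +
      2 * π * Complex.I * ((n : ℂ) + 1 / 2) * (1 / 2 + 1 / 2)))
      (deriv (fun t => jacobiThetaKW (1 / 2) t) τ) := by
  have := Complex.hasSum_deriv_of_summable_norm (ι := ℤ) (z := τ) (U := {t : ℂ | τ.im / 2 < t.im})
    (F := fun n t => Complex.exp (π * Complex.I * ((n : ℂ) + 1 / 2) ^ 2 * t +
      2 * π * Complex.I * ((n : ℂ) + 1 / 2) * (1 / 2 + 1 / 2)))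
    (kwB_summable (half_pos hτ)) (fun n => by fun_prop)
    (isOpen_lt continuous_const Complex.continuous_im)
    (fun n t ht => kw_bound (half_pos hτ) (1 / 2) t (le_of_lt ht) (by norm_num) n)
    (by simp; linarith)
  refine hs_congr this fun n => ?_
  have h : HasDerivAt (fun t : ℂ => Complex.exp (π * Complex.I * ((n : ℂ) + 1 / 2) ^ 2 * t +
      2 * π * Complex.I * ((n : ℂ) + 1 / 2) * (1 / 2 + 1 / 2))) _ τ :=
    (((hasDerivAt_id τ).const_mul _).add_const _).cexp
  rw [h.deriv]
  simp only [id]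
  ring

lemma kw_deriv_z (τ : ℂ) (hτ : 0 < τ.im) :
    HasSum (fun n : ℤ => (2 * π * Complex.I * ((n : ℂ) + 1 / 2)) ^ 2 *
      Complex.exp (π * Complex.I * ((n : ℂ) + 1 / 2) ^ 2 * τ +
      2 * π * Complex.I * ((n : ℂ) + 1 / 2) * (1 / 2 + 1 / 2)))
      (iteratedDeriv 2 (fun z => jacobiThetaKW z τ) (1 / 2)) := by
  let U : Set ℂ := {z | |z.im| < 1}
  have hU : IsOpen U := isOpen_lt (by fun_prop) continuous_const
  let F : ℤ → ℂ → ℂ := fun n z => Complex.exp (π * Complex.I * ((n : ℂ) + 1 / 2) ^ 2 * τ +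
      2 * π * Complex.I * ((n : ℂ) + 1 / 2) * (z + 1 / 2))
  have hc := (tendstoUniformlyOn_tsum (kwB_summable hτ) (f := F) (s := U)
    (fun n z hz => kw_bound hτ z τ le_rfl (le_of_lt hz) n)).tendstoLocallyUniformlyOn
  have hd : ∀ n, Differentiable ℂ (F n) := fun n => by fun_prop
  have hF1 : ∀ n, deriv (F n) = fun z => (2 * π * Complex.I * ((n : ℂ) + 1 / 2)) * F n z := by
    intro n; ext z
    have : HasDerivAt (F n) (F n z * ((2 * π * Complex.I * ((n : ℂ) + 1 / 2)) * 1)) z :=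
      ((((hasDerivAt_id z).add_const _).const_mul _).const_add _).cexp
    rw [this.deriv]; ring
  have h1 := hc.deriv (Filter.Eventually.of_forall fun s =>
    (Differentiable.fun_sum fun n _ => hd n).differentiableOn) hU
  have e1 : (deriv ∘ fun (s : Finset ℤ) z => ∑ n ∈ s, F n z) =
      fun (s : Finset ℤ) z => ∑ n ∈ s, (2 * π * Complex.I * ((n : ℂ) + 1 / 2)) * F n z := by
    ext s z
    simp only [Function.comp]
    rw [deriv_fun_sum fun n _ => hd n z]
    simp [hF1]
  rw [e1] at h1
  have h2 := h1.deriv (Filter.Eventually.of_forall fun s =>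
    (Differentiable.fun_sum fun n _ => (hd n).const_mul _).differentiableOn) hU
  have h3 := h2.tendsto_at (a := 1 / 2) (by simp [U])
  rw [iteratedDeriv_succ, iteratedDeriv_one]
  rw [HasSum]
  refine h3.congr fun s => ?_
  simp only [Function.comp]
  rw [deriv_fun_sum fun n _ => (hd n _).const_mul _]
  refine Finset.sum_congr rfl fun n _ => ?_
  rw [deriv_const_mul _ (hd n _), hF1]
  simp only [F]
  ring

lemma heat (τ : ℂ) (hτ : 0 < τ.im) :
    iteratedDeriv 2 (fun z => jacobiThetaKW z τ) (1 / 2) =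
      4 * π * Complex.I * deriv (fun t => jacobiThetaKW (1 / 2) t) τ := by
  refine (kw_deriv_z τ hτ).unique ?_
  refine hs_congr ((kw_deriv_tau τ hτ).mul_left (4 * π * Complex.I)) fun n => ?_
  ring

lemma kw_half (τ : ℂ) (hτ : 0 < τ.im) :
    jacobiThetaKW (1 / 2) τ = -2 * ModularForm.eta (2 * τ) ^ 2 / ModularForm.eta τ := by
  set x := Complex.exp (2 * π * Complex.I * τ) with hxdef
  have hx : ‖x‖ < 1 := UpperHalfPlane.norm_exp_two_pi_I_lt_one ⟨τ, hτ⟩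
  have hg := gauss_tri x hx
  have key : ∀ s : ℕ, Complex.exp (π * Complex.I * ((s : ℂ) + 1 / 2) ^ 2 * τ +
      2 * π * Complex.I * ((s : ℂ) + 1 / 2) * (1 / 2 + 1 / 2)) =
      -Complex.exp (π * Complex.I * τ / 4) * x ^ (s * (s + 1) / 2) := by
    intro s
    obtain ⟨t, ht⟩ : ∃ t, s * (s + 1) = 2 * t := (Nat.even_mul_succ_self s).two_dvd
    have htc : (s : ℂ) * (s + 1) = 2 * t := by exact_mod_cast ht
    rw [ht, Nat.mul_div_cancel_left _ two_pos, hxdef, ← Complex.exp_nat_mul]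
    have : (π * Complex.I * ((s : ℂ) + 1 / 2) ^ 2 * τ +
      2 * π * Complex.I * ((s : ℂ) + 1 / 2) * (1 / 2 + 1 / 2)) =
      π * Complex.I * τ / 4 + t * (2 * π * Complex.I * τ) + (s * (2 * π * Complex.I)
        + π * Complex.I) := by
      linear_combination (π * Complex.I * τ) * htc
    rw [this, Complex.exp_add, Complex.exp_add, Complex.exp_add, Complex.exp_pi_mul_I,
      Complex.exp_nat_mul_two_pi_mul_I]
    ring
  have hS := ((summable_tri x hx).hasSum).mul_left (-Complex.exp (π * Complex.I * τ / 4))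
  have hsum : jacobiThetaKW (1 / 2) τ = -Complex.exp (π * Complex.I * τ / 4) *
      (∑' s : ℕ, x ^ (s * (s + 1) / 2)) + -Complex.exp (π * Complex.I * τ / 4) *
      (∑' s : ℕ, x ^ (s * (s + 1) / 2)) := by
    refine HasSum.tsum_eq (HasSum.of_nat_of_neg_add_one ?_ ?_)
    · refine hs_congr hS fun s => ?_
      rw [← key]; push_cast; rfl
    · refine hs_congr hS fun s => ?_
      rw [← key]
      rw [Complex.exp_eq_exp_iff_exists_int]
      refine ⟨-(2 * s + 1), ?_⟩
      push_cast; ring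
  rw [hsum, hg]
  have e1 : ModularForm.eta τ = Complex.exp (π * Complex.I * τ / 12) *
      ∏' k : ℕ, (1 - x ^ (k + 1)) := by
    rw [ModularForm.eta]
    simp_rw [ModularForm.eta_q_eq_pow]
    congr 1
    rw [Function.Periodic.qParam]; congr 1; push_cast; ring
  have e2 : ModularForm.eta (2 * τ) = Complex.exp (π * Complex.I * τ / 6) *
      ∏' k : ℕ, (1 - (x ^ 2) ^ (k + 1)) := by
    rw [ModularForm.eta]
    simp_rw [ModularForm.eta_q_eq_pow]
    have : Complex.exp (2 * π * Complex.I * (2 * τ)) = x ^ 2 := by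
      rw [hxdef, ← Complex.exp_nat_mul]; congr 1; push_cast; ring
    rw [this]
    congr 1
    rw [Function.Periodic.qParam]; congr 1; push_cast; ring
  rw [e1, e2]
  have h0 := tprod_pow_ne x hx
  have h5 := Complex.exp_ne_zero (π * Complex.I * τ / 12)
  have e3 : Complex.exp (π * Complex.I * τ / 4) = Complex.exp (π * Complex.I * τ / 12) ^ 3 := by
    rw [← Complex.exp_nat_mul]; congr 1; push_cast; ring
  have e4 : Complex.exp (π * Complex.I * τ / 6) = Complex.exp (π * Complex.I * τ / 12) ^ 2 := by
    rw [← Complex.exp_nat_mul]; congr 1; push_cast; ring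
  rw [e3, e4]
  field_simp
  ring

lemma eisE2 (τ : ℂ) (hτ : 0 < τ.im) :
    eisensteinE2 τ = EisensteinSeries.E2 ⟨τ, hτ⟩ := by
  rw [EisensteinSeries.E2_eq_tsum_cexp, eisensteinE2, tsum_pnat_eq_tsum_succ
    (f := fun n ↦ (ArithmeticFunction.sigma 1 n : ℂ) * Complex.exp (2 * π * Complex.I * τ) ^ n)]
  congr 2
  refine tsum_congr fun k => ?_
  rw [← Complex.exp_nat_mul]
  congr 2
  push_cast; ring

lemma eta_deriv (τ : ℂ) (hτ : 0 < τ.im) :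
    HasDerivAt ModularForm.eta (π * Complex.I / 12 * eisensteinE2 τ * ModularForm.eta τ) τ := by
  have h := (ModularForm.differentiableAt_eta_of_mem_upperHalfPlaneSet hτ).hasDerivAt
  have h0 := ModularForm.eta_ne_zero hτ
  have h2 := ModularForm.logDeriv_eta_eq_E2 ⟨τ, hτ⟩
  rw [← eisE2, logDeriv_apply, div_eq_iff h0] at h2
  rw [← h2]
  exact h

/-- For every `τ ∈ ℍ` one has
`(1/(2πi)²) · ϑ''(1/2; τ)/ϑ(1/2; τ) = −(1/12) E₂(τ) + (1/3) E₂(2τ)`, where `ϑ''(1/2;τ)`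
denotes the second derivative of `ϑ(z;τ)` in `z` evaluated at `z = 1/2`. -/
theorem stmt_12 (τ : ℂ) (hτ : 0 < τ.im) :
    (1 / (2 * π * Complex.I) ^ 2) *
        iteratedDeriv 2 (fun z : ℂ => jacobiThetaKW z τ) (1 / 2) / jacobiThetaKW (1 / 2) τ
      = -(1 / 12) * eisensteinE2 τ + (1 / 3) * eisensteinE2 (2 * τ) := by
  have hτ2 : 0 < (2 * τ).im := by simpa using hτ
  have h1 := ModularForm.eta_ne_zero hτ
  have h2 := ModularForm.eta_ne_zero hτ2
  have d1 := eta_deriv τ hτ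
  have d2 : HasDerivAt (fun t : ℂ => ModularForm.eta (2 * t)) _ τ :=
    HasDerivAt.comp τ (eta_deriv (2 * τ) hτ2) ((hasDerivAt_id τ).const_mul 2)
  have d3 := ((d2.pow 2).const_mul (-2)).div d1 h1
  have hev : ∀ᶠ t in nhds τ, jacobiThetaKW (1 / 2) t =
      ((fun y : ℂ => -2 * ((fun t : ℂ => ModularForm.eta (2 * t)) ^ 2) y) / ModularForm.eta) t := by
    filter_upwards [(isOpen_lt continuous_const Complex.continuous_im).mem_nhds hτ] with t ht
    exact kw_half t ht
  have d4 := d3.congr_of_eventuallyEq hev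
  rw [heat τ hτ, d4.deriv, kw_half τ hτ]
  have hpi : (π : ℂ) ≠ 0 := by exact_mod_cast Real.pi_ne_zero
  have hI := Complex.I_ne_zero
  simp only [Pi.pow_apply]
  field_simp
  ring
end
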